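/- (Generalized CK-extension) Let Ω₀ ⊆ ℝ^{p+1} be a domain and f₀ : Ω₀ → ℝ_{p+q} real analytic. Then there exists a unique sequence of real analytic functions {f_k}_{k≥1} on Ω₀ such that the series f(𝐱) = GCK[f₀](𝐱) = Σ_{k=0}^{∞} 𝐱_q^k f_k(𝐱_p) converges in a p-symmetric slice domain Ω ⊆ Ω₀* containing Ω₀ and its sum f is monogenic in Ω. The coefficients are given explicitly by f_{2k} = ( Γ(q/2) / (2^{2k} k! Γ(k + q/2)) ) Δ_{𝐱_p}^k f₀ and f_{2k+1} = ( Γ(q/2) / (2^{2k+1} k! Γ(k + q/2 + 1)) ) D_{𝐱_p} Δ_{𝐱_p}^k f₀; equivalently f(𝐱) = Σ_{k=0}^{∞} ( Γ(q/2)(−1)^k r^{2k} / (2^{2k} k! Γ(k+q/2)) ) Δ_{𝐱_p}^k f₀(𝐱_p) + 𝐱_q D_{𝐱_p} Σ_{k=0}^{∞} ( Γ(q/2)(−1)^k r^{2k} / (2^{2k+1} k! Γ(k+q/2+1)) ) Δ_{𝐱_p}^k f₀(𝐱_p), with r = |𝐱_q|. -/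

import Mathlib

/-!
Common framework for generalized partial-slice monogenic functions
(Xu–Sabadini, "On the Fueter-Sce theorem for generalized partial-slice
monogenic functions").

The real Clifford algebra `ℝ_{p+q}` is formalized as the Mathlib Clifford
algebra of the negative-definite quadratic form on `ℝ^{p+q}`; since Mathlib
provides no canonical norm on it, all analytic statements are phrased for an
arbitrary normed real algebra `A` together with an `ℝ`-algebra isomorphism
`ξ : A ≃ₐ[ℝ] Cl (p+q)`.  A point of `ℝ^{p+q+1}` is a pair
`(𝐱_p, 𝐱_q) : (Fin (p+1) → ℝ) × EuclideanSpace ℝ (Fin q)`, and a point of a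
slice `ℝ^{p+2}` is a pair `(𝐱_p, r)`.
-/

noncomputable section

open Filter Topology MeasureTheory Metric
open scoped Nat RealInnerProductSpace

namespace GPS

/-- The negative definite quadratic form `-(x₁² + ⋯ + xₙ²)` on `ℝⁿ`. -/
def Qe (n : ℕ) : QuadraticForm ℝ (Fin n → ℝ) :=
  QuadraticMap.weightedSumSquares ℝ (fun _ : Fin n => (-1 : ℝ))

/-- The real Clifford algebra `ℝ_n`. -/
abbrev Cl (n : ℕ) : Type := CliffordAlgebra (Qe n)

/-- The generators `e_1, …, e_n` of `ℝ_n` (indexed by `Fin n`). -/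
def e (n : ℕ) (i : Fin n) : Cl n := CliffordAlgebra.ι (Qe n) (Pi.single i 1)

variable (p q : ℕ)

/-- `ℝ^{p+1}`, the "slice-axis" space. -/
abbrev Vp : Type := Fin (p + 1) → ℝ

/-- `ℝ^q`. -/
abbrev Vq : Type := EuclideanSpace ℝ (Fin q)

/-- `ℝ^{p+q+1} = ℝ^{p+1} ⊕ ℝ^q`. -/
abbrev V : Type := Vp p × Vq q

/-- `ℝ^{p+2}`, the parameter space `(𝐱_p, r)` of a slice. -/
abbrev Sl : Type := Vp p × ℝ

/-- The sphere `𝕊` of unit 1-vectors, described by their coordinate vectors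
`(x_{p+1}, …, x_{p+q}) ∈ ℝ^q` with `∑ x_i² = 1`. -/
def S : Set (Vq q) := {v | ∑ j, v j ^ 2 = 1}

/-- The point `𝐱_p + r ω` of `ℝ^{p+q+1}`. -/
def spt (v : Vq q) (z : Sl p) : V p q := (z.1, z.2 • v)

/-- The (parameterized) slice `Ω_ω` of a set `Ω ⊆ ℝ^{p+q+1}`. -/
def sliceSet (Ω : Set (V p q)) (v : Vq q) : Set (Sl p) := {z | spt p q v z ∈ Ω}

/-- `Ω₀* = {𝐱_p + 𝐱_q : 𝐱_p ∈ Ω₀, 𝐱_q ∈ ℝ^q}`. -/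
def star0 (Ω₀ : Set (Vp p)) : Set (V p q) := {z | z.1 ∈ Ω₀}

/-- The p-symmetric completion `Ω_D` of a set `D ⊆ ℝ^{p+2}`. -/
def completion (D : Set (Sl p)) : Set (V p q) :=
  {x | ∃ z ∈ D, ∃ v ∈ S q, x = spt p q v z}

/-- `D` is invariant under the reflection of the `(p+2)`-th variable. -/
def ReflInv (D : Set (Sl p)) : Prop := ∀ z ∈ D, ((z.1, -z.2) : Sl p) ∈ D

/-- A domain: a nonempty open connected set. -/
def IsDomain {E : Type*} [TopologicalSpace E] (s : Set E) : Prop :=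
  IsOpen s ∧ IsConnected s

/-- A slice domain. -/
def IsSliceDomain (Ω : Set (V p q)) : Prop :=
  IsDomain Ω ∧ (∃ x : Vp p, ((x, 0) : V p q) ∈ Ω) ∧
    ∀ v ∈ S q, IsDomain (sliceSet p q Ω v)

/-- Partial symmetry with respect to `ℝ^{p+1}`. -/
def IsPSymmetric (Ω : Set (V p q)) : Prop :=
  ∀ (x : Vp p) (r : ℝ), ∀ v ∈ S q, ∀ w ∈ S q,
    ((x, r • v) : V p q) ∈ Ω → ((x, r • w) : V p q) ∈ Ω

/-- A `d`-dimensional smooth submanifold of a real normed space. -/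
def IsSmoothSubmanifoldDim {E : Type*} [NormedAddCommGroup E] [NormedSpace ℝ E]
    (d : ℕ) (M : Set E) : Prop :=
  ∀ x ∈ M, ∃ U : Set E, IsOpen U ∧ x ∈ U ∧
    ∃ (ψ : (Fin d → ℝ) → E) (W : Set (Fin d → ℝ)), IsOpen W ∧
      ContDiffOn ℝ (⊤ : ℕ∞) ψ W ∧ Set.InjOn ψ W ∧
      (∀ y ∈ W, Function.Injective (fderivWithin ℝ ψ W y)) ∧
      M ∩ U = ψ '' W

variable {A : Type*} [NormedRing A] [NormedAlgebra ℝ A] (ξ : A ≃ₐ[ℝ] Cl (p + q))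

/-- The generators `e_1, …, e_{p+q}` inside `A`. -/
def gen (i : Fin (p + q)) : A := ξ.symm (e (p + q) i)

/-- The generators `e_{p+1}, …, e_{p+q}` (the "q-part"). -/
def eQ (j : Fin q) : A := gen p q ξ ⟨p + (j : ℕ), by have := j.isLt; omega⟩

/-- The generators `e_1, …, e_p` (the "p-part", without `e_0 = 1`). -/
def eP (i : Fin p) : A := gen p q ξ ⟨(i : ℕ), by have := i.isLt; omega⟩

/-- `e_0 = 1, e_1, …, e_p`: the paravector basis of `ℝ^{p+1}` inside `A`. -/
def εp (i : Fin (p + 1)) : A :=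
  if h : (i : ℕ) = 0 then 1 else gen p q ξ ⟨(i : ℕ) - 1, by have := i.isLt; omega⟩

/-- The 1-vector `∑ x_i e_{p+i} ∈ A` corresponding to `𝐱_q ∈ ℝ^q`;
for a unit `v` this is the imaginary unit `ω ∈ 𝕊`. -/
def ωCl (v : Vq q) : A := ∑ j, v j • eQ p q ξ j

/-- The paravector `x_0 + x_1 e_1 + ⋯ + x_p e_p ∈ A` of `𝐱_p ∈ ℝ^{p+1}`. -/
def clP (x : Vp p) : A := ∑ i, x i • εp p q ξ i

/-- The paravector of `𝐱 ∈ ℝ^{p+q+1}` in `A`. -/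
def toCl (z : V p q) : A := clP p q ξ z.1 + ωCl p q ξ z.2

section SliceOperators

variable {F' : Type*} [NormedAddCommGroup F'] [NormedSpace ℝ F']

/-- `∂_{x_i}` on functions on `ℝ^{p+2}`. -/
def pdSl (i : Fin (p + 1)) (F : Sl p → F') : Sl p → F' :=
  fun z => fderiv ℝ F z (Pi.single i 1, 0)

/-- `∂_r` on functions on `ℝ^{p+2}`. -/
def pdr (F : Sl p → F') : Sl p → F' := fun z => fderiv ℝ F z (0, 1)

/-- `∂_{x_i}` (first factor) on functions on `ℝ^{p+q+1}`. -/
def pdV1 (i : Fin (p + 1)) (f : V p q → F') : V p q → F' :=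
  fun z => fderiv ℝ f z ((Pi.single i 1 : Vp p), 0)

/-- `∂_{x_{p+j}}` (second factor) on functions on `ℝ^{p+q+1}`. -/
def pdV2 (j : Fin q) (f : V p q → F') : V p q → F' :=
  fun z => fderiv ℝ f z (0, EuclideanSpace.single j 1)

/-- `∂_{x_i}` on functions on `ℝ^{p+1}`. -/
def pdP (i : Fin (p + 1)) (g : Vp p → F') : Vp p → F' :=
  fun x => fderiv ℝ g x (Pi.single i 1)

/-- The Laplacian `Δ_{𝐱'} = Δ_{𝐱_p} + ∂_r²` on `ℝ^{p+2}`. -/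
def LapSl (F : Sl p → F') : Sl p → F' :=
  fun z => ∑ i, pdSl p (i := i) (pdSl p i F) z + pdr p (pdr p F) z

/-- The Laplacian `Δ_𝐱` on `ℝ^{p+q+1}`. -/
def LapV (f : V p q → F') : V p q → F' :=
  fun z => ∑ i, pdV1 p q i (pdV1 p q i f) z + ∑ j, pdV2 p q j (pdV2 p q j f) z

/-- The Laplacian `Δ_{𝐱_p}` on `ℝ^{p+1}`. -/
def LapP (g : Vp p → F') : Vp p → F' :=
  fun x => ∑ i, pdP p i (pdP p i g) x

end SliceOperators

/-- The generalized Cauchy–Riemann operator `D_{𝐱_p} = ∑_{i=0}^p e_i ∂_{x_i}`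
on slice functions. -/
def DP (F : Sl p → A) : Sl p → A :=
  fun z => ∑ i, εp p q ξ i * pdSl p i F z

/-- The conjugated operator `D̄_{𝐱_p} = ∂_{x_0} - ∑_{i=1}^p e_i ∂_{x_i}`. -/
def DPbar (F : Sl p → A) : Sl p → A :=
  fun z => pdSl p 0 F z - ∑ i : Fin p, eP p q ξ i * pdSl p i.succ F z

/-- The generalized Cauchy–Riemann (Dirac) operator `D_𝐱` on `ℝ^{p+q+1}`. -/
def DV (f : V p q → A) : V p q → A :=
  fun z => ∑ i, εp p q ξ i * pdV1 p q i f z + ∑ j, eQ p q ξ j * pdV2 p q j f z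

/-- `D_{𝐱_p} = ∑_{i=0}^p e_i ∂_{x_i}` on functions on `ℝ^{p+1}`. -/
def DPfun (g : Vp p → A) : Vp p → A :=
  fun x => ∑ i, εp p q ξ i * pdP p i g x

/-- The slice operator `D_ω = D_{𝐱_p} + ω ∂_r`, expressed on `ℝ^{p+q+1} ∖ ℝ^{p+1}`
(at `𝐱_q = 0` the radial part is junk `0`). -/
def Dslice (f : V p q → A) : V p q → A :=
  fun z => ∑ i, εp p q ξ i * pdV1 p q i f z
    + ωCl p q ξ (‖z.2‖⁻¹ • z.2) * fderiv ℝ f z (0, ‖z.2‖⁻¹ • z.2)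

/-- The spherical Dirac operator `Γ = -∑_{i<j} e_i e_j L_{ij}` on the `ℝ^q` variables. -/
def sphericalDirac (f : V p q → A) : V p q → A :=
  fun z => - ∑ i : Fin q, ∑ j : Fin q,
    if (i : ℕ) < (j : ℕ) then
      eQ p q ξ i * eQ p q ξ j *
        (z.2 i • pdV2 p q j f z - z.2 j • pdV2 p q i f z)
    else 0

/-- `f` is left generalized partial-slice monogenic of type `(p,q)` on `Ω`. -/
def GSMOn (Ω : Set (V p q)) (f : V p q → A) : Prop :=
  ∀ v ∈ S q,
    ContDiffOn ℝ 1 (fun z => f (spt p q v z)) (sliceSet p q Ω v) ∧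
    ∀ z ∈ sliceSet p q Ω v,
      DP p q ξ (fun w => f (spt p q v w)) z
        + ωCl p q ξ v * pdr p (fun w => f (spt p q v w)) z = 0

/-- `f` is (left) monogenic on `Ω`. -/
def MonogenicOn (Ω : Set (V p q)) (f : V p q → A) : Prop :=
  ContDiffOn ℝ 1 f Ω ∧ ∀ z ∈ Ω, DV p q ξ f z = 0

/-- `f` is the generalized partial-slice function on `Ω_D` with components `F1, F2`
(an even–odd pair in the last variable). -/
def IsGPSlice (D : Set (Sl p)) (f : V p q → A) (F1 F2 : Sl p → A) : Prop :=
  (∀ z ∈ D, F1 (z.1, -z.2) = F1 z ∧ F2 (z.1, -z.2) = -F2 z) ∧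
  ∀ z ∈ D, ∀ v ∈ S q, f (spt p q v z) = F1 z + ωCl p q ξ v * F2 z

/-- The generalized Cauchy–Riemann system (2.6) for the pair `(F1, F2)`. -/
def CRSystem (D : Set (Sl p)) (F1 F2 : Sl p → A) : Prop :=
  ∀ z ∈ D, DP p q ξ F1 z - pdr p F2 z = 0 ∧ DPbar p q ξ F2 z + pdr p F1 z = 0

/-- `f ∈ 𝒢𝒮ℛ(Ω_D)` with the given components. -/
def GSROnWith (D : Set (Sl p)) (f : V p q → A) (F1 F2 : Sl p → A) : Prop :=
  IsGPSlice p q ξ D f F1 F2 ∧ ContDiffOn ℝ 1 F1 D ∧ ContDiffOn ℝ 1 F2 D ∧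
    CRSystem p q ξ D F1 F2

/-- `f ∈ 𝒢𝒮ℛ(Ω_D)`. -/
def GSROn (D : Set (Sl p)) (f : V p q → A) : Prop :=
  ∃ F1 F2, GSROnWith p q ξ D f F1 F2

/-- Iterates `((1/r) ∂_r)^k F`. -/
def AIter (F : Sl p → A) : ℕ → Sl p → A
  | 0 => F
  | k + 1 => fun z => z.2⁻¹ • pdr p (AIter F k) z

/-- Iterates `(∂_r (1/r))^k F`. -/
def BIter (F : Sl p → A) : ℕ → Sl p → A
  | 0 => F
  | k + 1 => fun z => fderiv ℝ (fun w : Sl p => w.2⁻¹ • BIter F k w) z (0, 1)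

/-- `C_q(k) = (q-1)(q-3)⋯(q-2k+1)`. -/
def Cq (k : ℕ) : ℝ := ∏ j ∈ Finset.range k, ((q : ℝ) - (2 * (j : ℝ) + 1))

/-- The Fueter–Sce map `τ_q = (1/(q-1)!!) Δ^{(q-1)/2}` (for odd `q`). -/
def tauq (f : V p q → A) : V p q → A :=
  fun z => (((q - 1)‼ : ℝ))⁻¹ • (LapV p q)^[(q - 1) / 2] f z

/-- `(𝐱_q D_{𝐱_p})^k`, for a fixed Clifford element `u` in place of `𝐱_q`. -/
def uDpow (u : A) : ℕ → (Vp p → A) → Vp p → A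
  | 0 => fun g => g
  | k + 1 => fun g x => u * DPfun p q ξ (uDpow u k g) x

/-- The `k`-th term of the slice Cauchy–Kovalevskaya extension series. -/
def ckTerm (f₀ : Vp p → A) (k : ℕ) (z : V p q) : A :=
  ((k ! : ℝ))⁻¹ • uDpow p q ξ (ωCl p q ξ z.2) k f₀ z.1

/-- The slice Cauchy–Kovalevskaya extension `CK[f₀]`. -/
def CKext (f₀ : Vp p → A) (z : V p q) : A := ∑' k, ckTerm p q ξ f₀ k z

/-- The `k`-th term of the CK-extension for a fixed direction `w`. -/
def ckDirTerm (w : Vq q) (f₀ : Vp p → A) (k : ℕ) (z : V p q) : A :=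
  ((⟪w, z.2⟫) ^ k / (k ! : ℝ)) • uDpow p q ξ (ωCl p q ξ w) k f₀ z.1

/-- The CK-extension for a fixed direction `w ∈ 𝕊`. -/
def CKdir (w : Vq q) (f₀ : Vp p → A) (z : V p q) : A :=
  ∑' k, ckDirTerm p q ξ w f₀ k z

/-- The coefficients of the generalized CK-extension:
`f_{2k} = (Γ(q/2) / (2^{2k} k! Γ(k+q/2))) Δ^k f₀` and
`f_{2k+1} = (Γ(q/2) / (2^{2k+1} k! Γ(k+q/2+1))) D Δ^k f₀`. -/
def gckCoeff (f₀ : Vp p → A) (k : ℕ) : Vp p → A :=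
  if k % 2 = 0 then
    fun x => (Real.Gamma ((q : ℝ) / 2) /
        (2 ^ k * ((k / 2)! : ℝ) * Real.Gamma (((k / 2 : ℕ) : ℝ) + (q : ℝ) / 2))) •
      (LapP p)^[k / 2] f₀ x
  else
    fun x => (Real.Gamma ((q : ℝ) / 2) /
        (2 ^ k * ((k / 2)! : ℝ) * Real.Gamma (((k / 2 : ℕ) : ℝ) + (q : ℝ) / 2 + 1))) •
      DPfun p q ξ ((LapP p)^[k / 2] f₀) x

/-- The `k`-th term `𝐱_q^k f_k(𝐱_p)` of the generalized CK-extension series. -/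
def gckTerm (f₀ : Vp p → A) (k : ℕ) (z : V p q) : A :=
  (ωCl p q ξ z.2) ^ k * gckCoeff p q ξ f₀ k z.1

/-- The generalized CK-extension `GCK[f₀]`. -/
def GCKext (f₀ : Vp p → A) (z : V p q) : A := ∑' k, gckTerm p q ξ f₀ k z

/-- The Radon transform `R[f](𝐱_p, r, ω) = ∫_{⟨𝐱_q,ω⟩=r} f(𝐱_p, 𝐱_q) dσ(𝐱_q)`. -/
def radon (f : V p q → A) (x : Vp p) (r : ℝ) (w : Vq q) : A :=
  ∫ u : ((Submodule.span ℝ {w})ᗮ : Submodule ℝ (Vq q)),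
    f (x, r • w + (u : Vq q))

/-- The (suitably normalized) surface measure on the unit sphere of `ℝ^q`. -/
def sphMeasure : Measure (sphere (0 : Vq q) 1) := volume.toSphere

/-- The dual Radon transform
`Ř[f](𝐱_p, 𝐱_q) = (1/A_q) ∫_𝕊 f(𝐱_p, ⟨𝐱_q, η⟩ η) dS(η)` (a spherical average). -/
def dualRadon (f : V p q → A) (z : V p q) : A :=
  ⨍ w : sphere (0 : Vq q) 1,
    f (z.1, (⟪((w : Vq q)), z.2⟫) • (w : Vq q)) ∂(sphMeasure q)

end GPS

namespace GPS

/-! ### The Clifford algebra: relations and finite-dimensionality -/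

theorem e_mul_self (n : ℕ) (i : Fin n) : e n i * e n i = -1 := by
  rw [e, CliffordAlgebra.ι_sq_scalar]
  have : Qe n (Pi.single i 1) = -1 := by
    simp [Qe, QuadraticMap.weightedSumSquares_apply, Pi.single_apply]
  rw [this, map_neg, map_one]

theorem e_anticomm (n : ℕ) {i j : Fin n} (h : i ≠ j) : e n i * e n j = -(e n j * e n i) := by
  rw [eq_neg_iff_add_eq_zero, e, e, CliffordAlgebra.ι_mul_ι_add_swap, QuadraticMap.polar]
  have : ∀ k : Fin n, ((Pi.single i 1 : Fin n → ℝ) k + (Pi.single j 1 : Fin n → ℝ) k)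
      * ((Pi.single i 1 : Fin n → ℝ) k + (Pi.single j 1 : Fin n → ℝ) k) =
      (Pi.single i 1 : Fin n → ℝ) k * (Pi.single i 1 : Fin n → ℝ) k +
      (Pi.single j 1 : Fin n → ℝ) k * (Pi.single j 1 : Fin n → ℝ) k := by
    intro k
    rcases eq_or_ne k i with rfl | hi
    · simp [h]
    · simp [hi]
  have h0 : Qe n (Pi.single i 1 + Pi.single j 1) - Qe n (Pi.single i 1) - Qe n (Pi.single j 1)
      = 0 := by
    simp only [Qe, QuadraticMap.weightedSumSquares_apply, Pi.add_apply, this, smul_eq_mul,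
      neg_one_mul, Finset.sum_neg_distrib, Finset.sum_add_distrib]
    ring
  rw [h0, map_zero]

/-- The product of the two-dimensional spaces `ℝ + ℝ e_i` over a list of indices. -/
def cliffordSpan (n : ℕ) (l : List (Fin n)) : Submodule ℝ (Cl n) :=
  (l.map fun i => 1 ⊔ Submodule.span ℝ {e n i}).prod

theorem cliffordSpan_fg (n : ℕ) (l : List (Fin n)) : (cliffordSpan n l).FG := by
  induction l with
  | nil => simpa [cliffordSpan, Submodule.one_eq_span] using Submodule.fg_span_singleton (1 : Cl n)
  | cons i l ih =>
    simp only [cliffordSpan, List.map_cons, List.prod_cons]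
    refine Submodule.FG.mul (Submodule.FG.sup ?_ (Submodule.fg_span_singleton _)) ih
    simpa [Submodule.one_eq_span] using Submodule.fg_span_singleton (1 : Cl n)

theorem one_le_cliffordSpan (n : ℕ) (l : List (Fin n)) : 1 ≤ cliffordSpan n l := by
  induction l with
  | nil => simp [cliffordSpan]
  | cons i l ih =>
    simp only [cliffordSpan, List.map_cons, List.prod_cons]
    calc (1 : Submodule ℝ (Cl n)) = 1 * 1 := (one_mul 1).symm
      _ ≤ _ := mul_le_mul' le_sup_left ih

theorem span_mul_cliffordSpan_le (n : ℕ) (j : Fin n) (l : List (Fin n)) (hj : j ∈ l) :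
    Submodule.span ℝ {e n j} * cliffordSpan n l ≤ cliffordSpan n l := by
  induction l with
  | nil => simp at hj
  | cons i l ih =>
    simp only [cliffordSpan, List.map_cons, List.prod_cons]
    rw [← mul_assoc]
    by_cases hij : j = i
    · subst hij
      refine mul_le_mul_left ?_ _
      rw [Submodule.mul_sup, mul_one, Submodule.span_mul_span, Set.singleton_mul_singleton,
        e_mul_self]
      refine sup_le le_sup_right (le_trans ?_ le_sup_left)
      rw [Submodule.span_singleton_le_iff_mem]
      exact neg_mem (Submodule.one_le.1 le_rfl)
    · have h1 : Submodule.span ℝ {e n j} * (1 ⊔ Submodule.span ℝ {e n i}) ≤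
          (1 ⊔ Submodule.span ℝ {e n i}) * Submodule.span ℝ {e n j} := by
        rw [Submodule.mul_sup, mul_one, Submodule.sup_mul, one_mul, Submodule.span_mul_span,
          Submodule.span_mul_span, Set.singleton_mul_singleton, Set.singleton_mul_singleton,
          e_anticomm n hij]
        refine sup_le_sup_left ?_ _
        rw [Submodule.span_singleton_le_iff_mem]
        exact neg_mem (Submodule.mem_span_singleton_self _)
      refine (mul_le_mul_left h1 _).trans ?_
      rw [mul_assoc]
      exact mul_le_mul_right (ih (by simpa [hij] using hj)) _

theorem cliffordSpan_eq_top (n : ℕ) : cliffordSpan n (List.finRange n) = ⊤ := by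
  rw [eq_top_iff]
  rintro x -
  have h1 := Submodule.one_le.1 (one_le_cliffordSpan n (List.finRange n))
  induction x using CliffordAlgebra.left_induction with
  | algebraMap r =>
    rw [Algebra.algebraMap_eq_smul_one]
    exact Submodule.smul_mem _ _ h1
  | add x y hx hy => exact add_mem hx hy
  | ι_mul x m hx =>
    rw [pi_eq_sum_univ' m, map_sum, Finset.sum_mul]
    refine sum_mem fun j _ => ?_
    rw [map_smul, smul_mul_assoc]
    refine Submodule.smul_mem _ _ (span_mul_cliffordSpan_le n j _ (List.mem_finRange j) ?_)
    refine Submodule.mul_mem_mul ?_ hx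
    exact Submodule.mem_span_singleton_self _

theorem finiteDimensional_cl (n : ℕ) : FiniteDimensional ℝ (Cl n) :=
  ⟨cliffordSpan_eq_top n ▸ cliffordSpan_fg n _⟩


variable {p q : ℕ} {A : Type*} [NormedRing A] [NormedAlgebra ℝ A] (ξ : A ≃ₐ[ℝ] Cl (p + q))

theorem completeSpace_of_algEquiv {n : ℕ} (ξ : A ≃ₐ[ℝ] Cl n) : CompleteSpace A :=
  haveI := finiteDimensional_cl n
  haveI : FiniteDimensional ℝ A := ξ.symm.toLinearEquiv.finiteDimensional
  FiniteDimensional.complete ℝ A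

theorem gen_mul_self (i : Fin (p + q)) : gen p q ξ i * gen p q ξ i = -1 := by
  simp [gen, ← map_mul, e_mul_self]

theorem gen_anticomm {i j : Fin (p + q)} (h : i ≠ j) :
    gen p q ξ i * gen p q ξ j = -(gen p q ξ j * gen p q ξ i) := by
  simp only [gen, ← map_mul, e_anticomm _ h, map_neg]

theorem eQ_mul_self (j : Fin q) : eQ p q ξ j * eQ p q ξ j = -1 := gen_mul_self ξ _

theorem eQ_anticomm {i j : Fin q} (h : i ≠ j) :
    eQ p q ξ i * eQ p q ξ j = -(eQ p q ξ j * eQ p q ξ i) :=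
  gen_anticomm ξ (by simpa [Fin.ext_iff] using h)

theorem gen_mul_eQ {i : Fin (p + q)} (hi : (i : ℕ) < p) (j : Fin q) :
    gen p q ξ i * eQ p q ξ j = -(eQ p q ξ j * gen p q ξ i) :=
  gen_anticomm ξ (by rw [Ne, Fin.ext_iff]; simp; omega)

theorem gen_mul_ωCl {i : Fin (p + q)} (hi : (i : ℕ) < p) (v : Vq q) :
    gen p q ξ i * ωCl p q ξ v = -(ωCl p q ξ v * gen p q ξ i) := by
  simp only [ωCl, Finset.mul_sum, Finset.sum_mul, mul_smul_comm, smul_mul_assoc,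
    gen_mul_eQ ξ hi, smul_neg, Finset.sum_neg_distrib]

/-- `𝐱_q ↦ ∑ x_i e_{p+i}` as a continuous linear map. -/
def ωL : Vq q →L[ℝ] A := LinearMap.toContinuousLinearMap
  { toFun := ωCl p q ξ
    map_add' := fun x y => by simp [ωCl, add_smul, Finset.sum_add_distrib]
    map_smul' := fun c x => by simp [ωCl, mul_smul, Finset.smul_sum] }

theorem ωL_apply (v : Vq q) : ωL ξ v = ωCl p q ξ v := rfl

theorem ωCl_smul (r : ℝ) (v : Vq q) : ωCl p q ξ (r • v) = r • ωCl p q ξ v := (ωL ξ).map_smul r v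

theorem ωCl_single (j : Fin q) : ωCl p q ξ (EuclideanSpace.single j 1) = eQ p q ξ j := by
  simp [ωCl, ite_smul]

/-- A double sum whose coefficients have a diagonal symmetrization reduces to its diagonal. -/
theorem sum_sum_mul_of_anticomm {ι : Type*} [Fintype ι] [DecidableEq ι] (m h : ι → ι → A) (s : A)
    (hm : ∀ i j, i ≠ j → m i j = -m j i) (hd : ∀ i, m i i = s) (hh : ∀ i j, h i j = h j i) :
    ∑ i, ∑ j, m i j * h i j = ∑ i, s * h i i := by
  have h2 : (2 : ℝ) • ∑ i, ∑ j, m i j * h i j = (2 : ℝ) • ∑ i, s * h i i := by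
    calc (2 : ℝ) • ∑ i, ∑ j, m i j * h i j
        = ∑ i, ∑ j, m i j * h i j + ∑ i, ∑ j, m j i * h j i := by
          rw [two_smul, Finset.sum_comm (f := fun i j => m j i * h j i)]
      _ = ∑ i, ∑ j, (m i j + m j i) * h i j := by
          simp only [← Finset.sum_add_distrib, hh, add_mul]
      _ = ∑ i, ∑ j, if i = j then (2 : ℝ) • (s * h i i) else 0 := by
          refine Finset.sum_congr rfl fun i _ => Finset.sum_congr rfl fun j _ => ?_
          split_ifs with hij
          · subst hij
            rw [hd, add_mul, two_smul]
          · rw [hm i j hij, neg_add_cancel, zero_mul]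
      _ = _ := by simp [Finset.smul_sum]
  exact smul_right_injective A (two_ne_zero' ℝ) h2

theorem ωCl_mul_self (v : Vq q) : ωCl p q ξ v * ωCl p q ξ v = -(‖v‖ ^ 2 • (1 : A)) := by
  have h := sum_sum_mul_of_anticomm (fun i j => eQ p q ξ i * eQ p q ξ j)
    (fun i j => (v i * v j) • (1 : A)) (-1) (fun i j hij => eQ_anticomm ξ hij)
    (fun i => eQ_mul_self ξ i) (fun i j => by rw [mul_comm])
  rw [EuclideanSpace.real_norm_sq_eq, Finset.sum_smul, ← Finset.sum_neg_distrib]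
  simp only [ωCl, Finset.sum_mul, Finset.mul_sum]
  rw [Finset.sum_comm]
  calc _ = _ := ?_
    _ = _ := h
    _ = _ := ?_
  · simp [smul_smul, mul_comm]
  · simp [pow_two]
/-- The coefficients `e_i` of `D_{𝐱_p}` for even `k`, and `ē_i` of its conjugate for odd `k`. -/
def εc (k : ℕ) (i : Fin (p + 1)) : A :=
  if h : (i : ℕ) = 0 then 1
  else (-1 : ℝ) ^ k • gen p q ξ ⟨(i : ℕ) - 1, by have := i.isLt; omega⟩

theorem εc_zero (i : Fin (p + 1)) : εc ξ 0 i = εp p q ξ i := by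
  simp [εc, εp]

theorem εc_congr {k l : ℕ} (h : Even k ↔ Even l) (i : Fin (p + 1)) : εc ξ k i = εc ξ l i := by
  have : (-1 : ℝ) ^ k = (-1) ^ l := by
    by_cases hk : Even k
    · rw [hk.neg_one_pow, (h.1 hk).neg_one_pow]
    · rw [(Nat.not_even_iff_odd.1 hk).neg_one_pow,
        (Nat.not_even_iff_odd.1 (mt h.2 hk)).neg_one_pow]
  simp only [εc, this]

theorem εp_mul_ωCl_pow (k : ℕ) (i : Fin (p + 1)) (v : Vq q) :
    εp p q ξ i * ωCl p q ξ v ^ k = ωCl p q ξ v ^ k * εc ξ k i := by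
  induction k with
  | zero => simp [εc_zero]
  | succ k ih =>
    rw [pow_succ, ← mul_assoc, ih, mul_assoc, mul_assoc]
    congr 1
    unfold εc
    split_ifs with h
    · simp
    · rw [smul_mul_assoc, gen_mul_ωCl ξ (by have := i.isLt; simp; omega), pow_succ]
      simp

theorem εc_one_mul_self (i : Fin (p + 1)) : εc ξ 1 i * εp p q ξ i = 1 := by
  unfold εc εp
  split_ifs with h
  · simp
  · simp [gen_mul_self]

theorem εc_one_mul_anticomm {i j : Fin (p + 1)} (hij : i ≠ j) :
    εc ξ 1 i * εp p q ξ j = -(εc ξ 1 j * εp p q ξ i) := by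
  rw [Ne, Fin.ext_iff] at hij
  unfold εc εp
  split_ifs with h h' h'
  · omega
  · simp
  · simp
  · have := gen_anticomm ξ (p := p) (q := q) (i := ⟨(i : ℕ) - 1, by have := i.isLt; omega⟩)
      (j := ⟨(j : ℕ) - 1, by have := j.isLt; omega⟩) (by rw [Ne, Fin.ext_iff]; simp; omega)
    simp [this]

theorem ωCl_pow_two_mul (v : Vq q) (k : ℕ) :
    ωCl p q ξ v ^ (k + 2) = -(‖v‖ ^ 2 • ωCl p q ξ v ^ k) := by
  rw [pow_add, pow_two, ωCl_mul_self]
  simp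

theorem neg_ωCl_pow_mul_pow {v : Vq q} (hv : ‖v‖ = 1) (k : ℕ) :
    (-ωCl p q ξ v) ^ k * ωCl p q ξ v ^ k = 1 := by
  have h := ωCl_mul_self ξ v
  rw [hv] at h
  rw [← Commute.mul_pow ((Commute.refl _).neg_left), neg_mul, h]
  simp

theorem norm_pow_le_norm_one_mul {R : Type*} [NormedRing R] (a : R) (k : ℕ) :
    ‖a ^ k‖ ≤ ‖(1 : R)‖ * ‖a‖ ^ k := by
  induction k with
  | zero => simp
  | succ k ih =>
    rw [pow_succ, pow_succ, ← mul_assoc]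
    exact (norm_mul_le _ _).trans (by gcongr)

/-- The eigenvalues in `D_{𝐱_q} 𝐱_q^{k+1} = -c_k 𝐱_q^k`. -/
def diracCoeff (q k : ℕ) : ℝ := if k % 2 = 0 then k + q else k + 1

theorem diracCoeff_add_two (k : ℕ) : diracCoeff q (k + 2) = diracCoeff q k + 2 := by
  simp only [diracCoeff, Nat.add_mod_right]
  split_ifs <;> push_cast <;> ring

theorem succ_le_diracCoeff (hq : 1 ≤ q) (k : ℕ) : (k + 1 : ℝ) ≤ diracCoeff q k := by
  have : (1 : ℝ) ≤ q := by exact_mod_cast hq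
  unfold diracCoeff
  split_ifs <;> linarith

theorem diracCoeff_pos (hq : 1 ≤ q) (k : ℕ) : 0 < diracCoeff q k :=
  lt_of_lt_of_le (by positivity) (succ_le_diracCoeff hq k)

/-! ### Termwise differentiation of the series `∑ 𝐱_q^k f_k(𝐱_p)` -/

theorem contDiff_ωCl_pow (k : ℕ) : ContDiff ℝ 1 (fun v => ωCl p q ξ v ^ k) :=
  (ωL ξ).contDiff.pow k

theorem differentiable_ωCl_pow (k : ℕ) : Differentiable ℝ (fun v => ωCl p q ξ v ^ k) :=
  (contDiff_ωCl_pow ξ k).differentiable one_ne_zero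

theorem fderiv_mul_apply' {E : Type*} [NormedAddCommGroup E] [NormedSpace ℝ E] {a b : E → A}
    {x : E} (ha : DifferentiableAt ℝ a x) (hb : DifferentiableAt ℝ b x) (w : E) :
    fderiv ℝ (fun y => a y * b y) x w = a x * fderiv ℝ b x w + fderiv ℝ a x w * b x := by
  rw [fderiv_fun_mul' ha hb]
  simp

theorem norm_fderiv_mul_le {E : Type*} [NormedAddCommGroup E] [NormedSpace ℝ E] {a b : E → A}
    {x : E} (ha : DifferentiableAt ℝ a x) (hb : DifferentiableAt ℝ b x) :
    ‖fderiv ℝ (fun y => a y * b y) x‖ ≤ ‖a x‖ * ‖fderiv ℝ b x‖ + ‖fderiv ℝ a x‖ * ‖b x‖ := by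
  refine ContinuousLinearMap.opNorm_le_bound _ (by positivity) fun w => ?_
  rw [fderiv_mul_apply' ha hb]
  refine (norm_add_le _ _).trans ?_
  rw [add_mul]
  refine add_le_add ((norm_mul_le _ _).trans ?_) ((norm_mul_le _ _).trans ?_)
  · rw [mul_assoc]
    gcongr
    exact ContinuousLinearMap.le_opNorm _ _
  · rw [mul_right_comm]
    gcongr
    exact ContinuousLinearMap.le_opNorm _ _

/-- `D_{𝐱_q} 𝐱_q^{k+1} = -c_k 𝐱_q^k`. -/
theorem sum_eQ_mul_fderiv_ωCl_pow (k : ℕ) (v : Vq q) :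
    ∑ j, eQ p q ξ j * fderiv ℝ (fun v => ωCl p q ξ v ^ (k + 1)) v (EuclideanSpace.single j 1) =
      -(diracCoeff q k • ωCl p q ξ v ^ k) := by
  induction k using Nat.strong_induction_on with
  | _ k ih =>
  match k with
  | 0 =>
    have : (fun v => ωCl p q ξ v ^ (0 + 1)) = ωL ξ := by ext v; simp [ωL_apply]
    rw [this]
    simp [ωL_apply, ωCl_single, eQ_mul_self, diracCoeff, Nat.cast_smul_eq_nsmul]
  | k + 1 =>
    have hfun : (fun v => ωCl p q ξ v ^ (k + 1 + 1)) =
        fun v => (-(‖v‖ ^ 2 • (1 : A))) * ωCl p q ξ v ^ k := by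
      ext v; rw [ωCl_pow_two_mul]; simp
    have hd : ∀ w, HasFDerivAt (fun v : Vq q => (-(‖v‖ ^ 2 • (1 : A))))
        (-((2 • innerSL ℝ w).smulRight (1 : A))) w := fun w =>
      ((hasStrictFDerivAt_norm_sq w).hasFDerivAt.smul_const (1 : A)).neg
    have hlin : ∑ j, v j • eQ p q ξ j = ωCl p q ξ v := rfl
    simp only [hfun, fderiv_mul_apply' (hd v).differentiableAt (differentiable_ωCl_pow ξ k v),
      (hd v).fderiv, mul_add, Finset.sum_add_distrib]
    have h2 : ∑ j, eQ p q ξ j * ((-((2 • innerSL ℝ v).smulRight (1 : A)))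
        (EuclideanSpace.single j 1) * ωCl p q ξ v ^ k) = -((2 : ℝ) • ωCl p q ξ v ^ (k + 1)) := by
      rw [pow_succ', ← hlin, Finset.sum_mul, Finset.smul_sum, ← Finset.sum_neg_distrib]
      refine Finset.sum_congr rfl fun j _ => ?_
      simp [EuclideanSpace.inner_single_right, smul_smul]
    rw [h2]
    match k with
    | 0 => simp [diracCoeff]; norm_num
    | l + 1 =>
      have := ih l (by omega)
      simp only [neg_mul, smul_mul_assoc, one_mul, mul_neg, mul_smul_comm, Finset.sum_neg_distrib]
      rw [← Finset.smul_sum, this, diracCoeff_add_two, ωCl_pow_two_mul, add_smul]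
      simp only [smul_neg, neg_neg, smul_smul]
      rw [mul_comm]
      abel

theorem norm_fderiv_ωCl_pow_mul_le {v : Vq q} {a : ℝ} (hv : ‖ωCl p q ξ v‖ ≤ a) (k : ℕ) :
    ‖fderiv ℝ (fun v => ωCl p q ξ v ^ k) v‖ * a ≤ k * ‖(1 : A)‖ * ‖ωL ξ‖ * a ^ k := by
  have ha : 0 ≤ a := (norm_nonneg _).trans hv
  induction k with
  | zero => simp
  | succ k ih =>
    have h := norm_fderiv_mul_le (differentiable_ωCl_pow ξ k v) ((ωL ξ).differentiableAt (x := v))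
    have hfun : (fun v => ωCl p q ξ v ^ (k + 1)) = fun v => ωCl p q ξ v ^ k * ωL ξ v := by
      ext v; rw [pow_succ, ωL_apply]
    rw [hfun]
    rw [(ωL ξ).fderiv, ωL_apply] at h
    have h1 : ‖ωCl p q ξ v ^ k‖ ≤ ‖(1 : A)‖ * a ^ k :=
      (norm_pow_le_norm_one_mul _ _).trans (by gcongr)
    calc _ ≤ (‖(1 : A)‖ * a ^ k * ‖ωL ξ‖ +
          ‖fderiv ℝ (fun v => ωCl p q ξ v ^ k) v‖ * a) * a := by
          refine mul_le_mul_of_nonneg_right (h.trans ?_) ha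
          gcongr
      _ ≤ (‖(1 : A)‖ * a ^ k * ‖ωL ξ‖ + k * ‖(1 : A)‖ * ‖ωL ξ‖ * a ^ k) * a := by gcongr
      _ = _ := by push_cast; ring

/-- The value of the operator `D_𝐱` on a function with a given derivative. -/
def symbolDV (l : V p q →L[ℝ] A) : A :=
  ∑ i, εp p q ξ i * l (Pi.single i 1, 0) + ∑ j, eQ p q ξ j * l (0, EuclideanSpace.single j 1)

theorem hasSum_symbolDV {L : ℕ → V p q →L[ℝ] A} {l : V p q →L[ℝ] A} (h : HasSum L l) :
    HasSum (fun k => symbolDV ξ (L k)) (symbolDV ξ l) := by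
  have h' : ∀ w, HasSum (fun k => L k w) (l w) := fun w =>
    (ContinuousLinearMap.apply ℝ A w).hasSum h
  exact (hasSum_sum fun i _ => (h' _).mul_left _).add (hasSum_sum fun j _ => (h' _).mul_left _)

/-- The term `𝐱_q^k f(𝐱_p)`. -/
def axTerm (fs : ℕ → Vp p → A) (k : ℕ) (z : V p q) : A := ωCl p q ξ z.2 ^ k * fs k z.1

variable {fs : ℕ → Vp p → A} {z : V p q}

theorem differentiableAt_axTerm {k : ℕ} (h : DifferentiableAt ℝ (fs k) z.1) :
    DifferentiableAt ℝ (axTerm ξ fs k) z := by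
  have h1 : DifferentiableAt ℝ (fun z : V p q => ωCl p q ξ z.2 ^ k) z :=
    (differentiable_ωCl_pow ξ k z.2).comp z differentiableAt_snd
  exact h1.mul (h.comp z differentiableAt_fst)

theorem fderiv_axTerm_apply {k : ℕ} (h : DifferentiableAt ℝ (fs k) z.1) (w : V p q) :
    fderiv ℝ (axTerm ξ fs k) z w = ωCl p q ξ z.2 ^ k * fderiv ℝ (fs k) z.1 w.1 +
      fderiv ℝ (fun v => ωCl p q ξ v ^ k) z.2 w.2 * fs k z.1 := by
  have h1 : HasFDerivAt (fun z : V p q => ωCl p q ξ z.2 ^ k) _ z :=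
    (differentiable_ωCl_pow ξ k z.2).hasFDerivAt.comp z hasFDerivAt_snd
  have h2 : HasFDerivAt (fun z : V p q => fs k z.1) _ z := h.hasFDerivAt.comp z hasFDerivAt_fst
  have := fderiv_mul_apply' h1.differentiableAt h2.differentiableAt w
  rw [h1.fderiv, h2.fderiv] at this
  exact this

theorem norm_fderiv_axTerm_le {k : ℕ} {a B M : ℝ} (ha : 0 < a)
    (h : DifferentiableAt ℝ (fs k) z.1) (hv : ‖ωCl p q ξ z.2‖ ≤ a) (hB : ‖fs k z.1‖ ≤ B * M ^ k)
    (hB' : ‖fderiv ℝ (fs k) z.1‖ ≤ B * M ^ k) :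
    ‖fderiv ℝ (axTerm ξ fs k) z‖ ≤
      (‖(1 : A)‖ * B) * (a * M) ^ k + (‖(1 : A)‖ * ‖ωL ξ‖ * B / a) * (k * (a * M) ^ k) := by
  have hBM : 0 ≤ B * M ^ k := (norm_nonneg _).trans hB
  have h1 : ‖ωCl p q ξ z.2 ^ k‖ ≤ ‖(1 : A)‖ * a ^ k :=
    (norm_pow_le_norm_one_mul _ _).trans (by gcongr)
  have h2 := (le_div_iff₀ ha).2 (norm_fderiv_ωCl_pow_mul_le ξ hv k)
  have : (‖(1 : A)‖ * B) * (a * M) ^ k + (‖(1 : A)‖ * ‖ωL ξ‖ * B / a) * (k * (a * M) ^ k) =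
      ‖(1 : A)‖ * a ^ k * (B * M ^ k) + k * ‖(1 : A)‖ * ‖ωL ξ‖ * a ^ k / a * (B * M ^ k) := by
    rw [mul_pow]; ring
  rw [this]
  refine ContinuousLinearMap.opNorm_le_bound _ (by positivity) fun w => ?_
  rw [fderiv_axTerm_apply ξ h, add_mul]
  refine (norm_add_le _ _).trans (add_le_add ((norm_mul_le _ _).trans ?_)
    ((norm_mul_le _ _).trans ?_))
  · rw [mul_assoc _ _ ‖w‖]
    gcongr
    refine (ContinuousLinearMap.le_opNorm _ _).trans ?_
    gcongr
    exact norm_fst_le w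
  · rw [mul_right_comm]
    gcongr
    refine (ContinuousLinearMap.le_opNorm _ _).trans ?_
    gcongr
    exact norm_snd_le w

theorem norm_axTerm_le {k : ℕ} {a B M : ℝ} (hv : ‖ωCl p q ξ z.2‖ ≤ a)
    (hB : ‖fs k z.1‖ ≤ B * M ^ k) : ‖axTerm ξ fs k z‖ ≤ (‖(1 : A)‖ * B) * (a * M) ^ k := by
  have ha : 0 ≤ a := (norm_nonneg _).trans hv
  calc ‖axTerm ξ fs k z‖ ≤ ‖ωCl p q ξ z.2 ^ k‖ * ‖fs k z.1‖ := norm_mul_le _ _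
    _ ≤ (‖(1 : A)‖ * a ^ k) * (B * M ^ k) := by
      gcongr
      exact (norm_pow_le_norm_one_mul _ _).trans (by gcongr)
    _ = _ := by rw [mul_pow]; ring

theorem summable_axTerm_bound {a M : ℝ} (ha : 0 < a) (hM : 0 ≤ M) (haM : a * M < 1) (b c : ℝ) :
    Summable fun k : ℕ => b * (a * M) ^ k + c * (k * (a * M) ^ k) := by
  have h0 : 0 ≤ a * M := by positivity
  refine ((summable_geometric_of_lt_one h0 haM).mul_left b).add (Summable.mul_left c ?_)
  simpa using summable_pow_mul_geometric_of_norm_lt_one 1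
    (by rwa [Real.norm_of_nonneg h0] : ‖a * M‖ < 1)

/-- Termwise differentiation on a product of a convex open set with a small ball. -/
theorem hasFDerivAt_tsum_axTerm [CompleteSpace A] {U : Set (Vp p)} (hU : IsOpen U)
    (hUc : IsPreconnected U)
    {a B M s : ℝ} (ha : 0 < a) (hM : 0 ≤ M) (haM : a * M < 1)
    (hs : ∀ v ∈ ball (0 : Vq q) s, ‖ωCl p q ξ v‖ ≤ a)
    (hd : ∀ k, ∀ x ∈ U, DifferentiableAt ℝ (fs k) x)
    (hB : ∀ k, ∀ x ∈ U, ‖fs k x‖ ≤ B * M ^ k)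
    (hB' : ∀ k, ∀ x ∈ U, ‖fderiv ℝ (fs k) x‖ ≤ B * M ^ k) (hz : z ∈ U ×ˢ ball (0 : Vq q) s) :
    Summable (fun k => axTerm ξ fs k z) ∧ Summable (fun k => fderiv ℝ (axTerm ξ fs k) z) ∧
    HasFDerivAt (fun z => ∑' k, axTerm ξ fs k z) (∑' k, fderiv ℝ (axTerm ξ fs k) z) z := by
  have hsum : ∀ y ∈ U ×ˢ ball (0 : Vq q) s, Summable (fun k => axTerm ξ fs k y) := fun y hy => by
    refine Summable.of_norm_bounded ?_ fun k =>
      norm_axTerm_le ξ (hs _ hy.2) (hB k _ hy.1)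
    simpa using summable_axTerm_bound ha hM haM (‖(1 : A)‖ * B) 0
  have hbd := summable_axTerm_bound ha hM haM (‖(1 : A)‖ * B) (‖(1 : A)‖ * ‖ωL ξ‖ * B / a)
  have hle : ∀ k, ∀ y ∈ U ×ˢ ball (0 : Vq q) s, _ := fun k y hy =>
    norm_fderiv_axTerm_le ξ ha (hd k _ hy.1) (hs _ hy.2) (hB k _ hy.1) (hB' k _ hy.1)
  refine ⟨hsum z hz, Summable.of_norm_bounded hbd fun k => hle k z hz, ?_⟩
  exact hasFDerivAt_tsum_of_isPreconnected hbd (hU.prod isOpen_ball)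
    (hUc.prod (convex_ball _ _).isPreconnected)
    (fun k y hy => (differentiableAt_axTerm ξ (hd k _ hy.1)).hasFDerivAt) hle hz (hsum z hz) hz

/-! ### The operators `D_{𝐱_p}` and its conjugate on functions of `𝐱_p` -/

/-- `D_{𝐱_p}` for even `k` and its conjugate for odd `k`. -/
def altD (k : ℕ) (g : Vp p → A) (x : Vp p) : A := ∑ i, εc ξ k i * pdP p i g x

variable {fs : ℕ → Vp p → A} {z : V p q}

theorem symbolDV_fderiv_axTerm_zero (h : DifferentiableAt ℝ (fs 0) z.1) :
    symbolDV ξ (fderiv ℝ (axTerm ξ fs 0) z) = altD ξ 0 (fs 0) z.1 := by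
  simp [symbolDV, fderiv_axTerm_apply ξ h, altD, εc_zero, pdP]

theorem sum_εp_mul_ωCl_pow_mul_fderiv (k : ℕ) (g : Vp p → A) (v : Vq q) (x : Vp p) :
    ∑ i, εp p q ξ i * (ωCl p q ξ v ^ k * fderiv ℝ g x (Pi.single i 1)) =
      ωCl p q ξ v ^ k * altD ξ k g x := by
  simp only [← mul_assoc, εp_mul_ωCl_pow, altD, Finset.mul_sum, pdP]

theorem symbolDV_fderiv_axTerm_succ {k : ℕ} (h : DifferentiableAt ℝ (fs (k + 1)) z.1) :
    symbolDV ξ (fderiv ℝ (axTerm ξ fs (k + 1)) z) =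
      ωCl p q ξ z.2 ^ (k + 1) * altD ξ (k + 1) (fs (k + 1)) z.1 -
        ωCl p q ξ z.2 ^ k * (diracCoeff q k • fs (k + 1) z.1) := by
  have := sum_eQ_mul_fderiv_ωCl_pow ξ k z.2
  simp only [symbolDV, fderiv_axTerm_apply ξ h, map_zero, mul_zero, zero_mul, zero_add, add_zero]
  rw [sum_εp_mul_ωCl_pow_mul_fderiv]
  simp only [← mul_assoc, ← Finset.sum_mul, this]
  simp [sub_eq_add_neg]

/-- The sum of the series is monogenic where the coefficients satisfy the recursion. -/
theorem contDiffAt_and_DV_tsum_axTerm [CompleteSpace A] {U : Set (Vp p)} (hU : IsOpen U)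
    (hUc : IsPreconnected U) {a B M s : ℝ} (ha : 0 < a) (hM : 0 ≤ M) (haM : a * M < 1)
    (hs : ∀ v ∈ ball (0 : Vq q) s, ‖ωCl p q ξ v‖ ≤ a)
    (hd : ∀ k, ContDiffOn ℝ 1 (fs k) U)
    (hB : ∀ k, ∀ x ∈ U, ‖fs k x‖ ≤ B * M ^ k)
    (hB' : ∀ k, ∀ x ∈ U, ‖fderiv ℝ (fs k) x‖ ≤ B * M ^ k)
    (hrec : ∀ k, ∀ x ∈ U, altD ξ k (fs k) x = diracCoeff q k • fs (k + 1) x)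
    (hz : z ∈ U ×ˢ ball (0 : Vq q) s) :
    ContDiffAt ℝ 1 (fun z => ∑' k, axTerm ξ fs k z) z ∧
      DV p q ξ (fun z => ∑' k, axTerm ξ fs k z) z = 0 := by
  have hdiff : ∀ k, ∀ x ∈ U, DifferentiableAt ℝ (fs k) x := fun k x hx =>
    ((hd k).contDiffAt (hU.mem_nhds hx)).differentiableAt one_ne_zero
  have key := fun y (hy : y ∈ U ×ˢ ball (0 : Vq q) s) =>
    hasFDerivAt_tsum_axTerm ξ hU hUc ha hM haM hs hdiff hB hB' hy
  have hopen : IsOpen (U ×ˢ ball (0 : Vq q) s) := hU.prod isOpen_ball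
  refine ⟨contDiffAt_one_iff.2 ⟨fun z => ∑' k, fderiv ℝ (axTerm ξ fs k) z, _,
    hopen.mem_nhds hz, ?_, fun y hy => (key y hy).2.2⟩, ?_⟩
  · refine continuousOn_tsum (fun k => ?_) (summable_axTerm_bound ha hM haM (‖(1 : A)‖ * B)
      (‖(1 : A)‖ * ‖ωL ξ‖ * B / a)) fun k y hy => norm_fderiv_axTerm_le ξ ha (hdiff k _ hy.1)
        (hs _ hy.2) (hB k _ hy.1) (hB' k _ hy.1)
    have : ContDiffOn ℝ 1 (axTerm ξ fs k) (U ×ˢ ball (0 : Vq q) s) :=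
      ((contDiff_ωCl_pow ξ k).comp contDiff_snd).contDiffOn.mul
        ((hd k).comp contDiff_fst.contDiffOn fun y hy => hy.1)
    exact this.continuousOn_fderiv_of_isOpen hopen le_rfl
  · obtain ⟨-, h2, h3⟩ := key z hz
    have hsum := hasSum_symbolDV ξ h2.hasSum
    have hDV : DV p q ξ (fun z => ∑' k, axTerm ξ fs k z) z =
        symbolDV ξ (∑' k, fderiv ℝ (axTerm ξ fs k) z) := by
      rw [← h3.fderiv]; rfl
    rw [hDV]
    obtain ⟨S, hS⟩ : Summable fun k => ωCl p q ξ z.2 ^ k * altD ξ k (fs k) z.1 := by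
      have : (fun k => ωCl p q ξ z.2 ^ k * altD ξ k (fs k) z.1) =
          fun k => ∑ i, εp p q ξ i * fderiv ℝ (axTerm ξ fs k) z (Pi.single i 1, 0) := by
        ext k
        rw [← sum_εp_mul_ωCl_pow_mul_fderiv]
        simp [fderiv_axTerm_apply ξ (hdiff k _ hz.1)]
      rw [this]
      exact summable_sum fun i _ =>
        ((ContinuousLinearMap.apply ℝ A _).summable h2).mul_left _
    refine hsum.unique ?_
    have h0 : symbolDV ξ (fderiv ℝ (axTerm ξ fs 0) z) =
        ωCl p q ξ z.2 ^ 0 * altD ξ 0 (fs 0) z.1 := by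
      rw [symbolDV_fderiv_axTerm_zero ξ (hdiff 0 _ hz.1), pow_zero, one_mul]
    have h1 : HasSum (fun k => symbolDV ξ (fderiv ℝ (axTerm ξ fs (k + 1)) z))
        (S - ωCl p q ξ z.2 ^ 0 * altD ξ 0 (fs 0) z.1 - S) := by
      have := (hasSum_nat_add_iff' 1).2 hS
      simp only [Finset.sum_range_one] at this
      convert! this.sub hS using 2 with k
      rw [symbolDV_fderiv_axTerm_succ ξ (hdiff _ _ hz.1), hrec k _ hz.1]
    have := (hasSum_nat_add_iff' (f := fun k => symbolDV ξ (fderiv ℝ (axTerm ξ fs k) z))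
      (g := 0) 1).1 (by
        rw [Finset.sum_range_one, h0]
        convert! h1 using 1
        abel)
    exact this

/-! ### Derivative bounds -/

/-- Locally uniform Cauchy estimates for real analytic functions. -/
theorem exists_norm_iteratedFDeriv_le {E F : Type*} [NormedAddCommGroup E]
    [NormedSpace ℝ E] [NormedAddCommGroup F] [NormedSpace ℝ F] [CompleteSpace F] {f : E → F}
    {x : E} (hf : AnalyticAt ℝ f x) :
    ∃ r > 0, ∃ C ≥ 0, ∃ M ≥ 0, ∀ m, ∀ y ∈ ball x r,
      ‖iteratedFDeriv ℝ m f y‖ ≤ C * m ! * M ^ m := by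
  obtain ⟨P, R, hP⟩ := hf
  obtain ⟨r, hr0, hr⟩ : ∃ r : NNReal, 0 < r ∧ (r + r : ENNReal) < R := by
    obtain ⟨r, hr0, hr⟩ := ENNReal.lt_iff_exists_nnreal_btwn.1 (ENNReal.half_pos hP.r_pos.ne')
    refine ⟨r, by exact_mod_cast hr0, ?_⟩
    calc (r + r : ENNReal) < R / 2 + R / 2 := ENNReal.add_lt_add hr hr
      _ = R := ENNReal.add_halves R
  have hsum := P.changeOriginSeries_summable_aux₁ (hr.trans_le hP.r_le)
  have hsum' := NNReal.summable_sigma.1 hsum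
  refine ⟨r, by exact_mod_cast hr0, (∑' s : Σ k l : ℕ, { s : Finset (Fin (k + l)) // s.card = l },
      ‖P (s.1 + s.2.1)‖₊ * r ^ s.2.1 * r ^ s.1 : NNReal), NNReal.coe_nonneg _, (r⁻¹ : NNReal),
      NNReal.coe_nonneg _, fun m y hy => ?_⟩
  obtain ⟨h, rfl⟩ : ∃ h, y = x + h := ⟨y - x, by abel⟩
  have hh : ‖h‖₊ < r := by
    rw [← NNReal.coe_lt_coe]
    simpa using hy
  have hhR : (‖h‖₊ : ENNReal) < R :=
    lt_of_lt_of_le (by exact_mod_cast hh) (le_self_add.trans hr.le)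
  have hP' := hP.changeOrigin hhR
  have hcoef : ‖P.changeOrigin h m‖₊ ≤ (∑' s : Σ k l : ℕ, { s : Finset (Fin (k + l)) // s.card = l },
      ‖P (s.1 + s.2.1)‖₊ * r ^ s.2.1 * r ^ s.1) * r⁻¹ ^ m := by
    rw [inv_pow, ← div_eq_mul_inv, le_div_iff₀ (by positivity)]
    calc _ ≤ (∑' s : Σ l : ℕ, { s : Finset (Fin (m + l)) // s.card = l },
          ‖P (m + s.1)‖₊ * r ^ s.1) * r ^ m := by
          gcongr
          refine (P.nnnorm_changeOrigin_le m (hhR.trans_le hP.r_le)).trans ?_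
          have hs2 := P.changeOriginSeries_summable_aux₂
            (lt_of_le_of_lt le_self_add (hr.trans_le hP.r_le)) m
          have hle : ∀ s : Σ l : ℕ, { s : Finset (Fin (m + l)) // s.card = l },
              ‖P (m + s.1)‖₊ * ‖h‖₊ ^ s.1 ≤ ‖P (m + s.1)‖₊ * r ^ s.1 := fun s => by gcongr
          exact (NNReal.summable_of_le hle hs2).tsum_le_tsum hle hs2
      _ = ∑' s : Σ l : ℕ, { s : Finset (Fin (m + l)) // s.card = l },
          ‖P (m + s.1)‖₊ * r ^ s.1 * r ^ m := by rw [NNReal.tsum_mul_right]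
      _ ≤ _ := by
          rw [hsum.tsum_sigma' hsum'.1]
          exact hsum'.2.le_tsum' m
  have hcoef' : ‖P.changeOrigin h m‖ ≤ (∑' s : Σ k l : ℕ, { s : Finset (Fin (k + l)) // s.card = l },
      ‖P (s.1 + s.2.1)‖₊ * r ^ s.2.1 * r ^ s.1 : NNReal) * ((r⁻¹ : NNReal) : ℝ) ^ m := by
    exact_mod_cast hcoef
  refine ContinuousMultilinearMap.opNorm_le_bound (by positivity) fun v => ?_
  rw [hP'.iteratedFDeriv_eq_sum_of_completeSpace]
  calc _ ≤ ∑ σ : Equiv.Perm (Fin m), ‖P.changeOrigin h m‖ * ∏ i, ‖v i‖ := by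
        refine norm_sum_le_of_le _ fun σ _ => ?_
        refine (ContinuousMultilinearMap.le_opNorm _ _).trans (le_of_eq ?_)
        congr 1
        exact Equiv.prod_comp σ fun i => ‖v i‖
    _ = m ! * ‖P.changeOrigin h m‖ * ∏ i, ‖v i‖ := by
        simp [Fintype.card_perm, mul_assoc]
    _ ≤ m ! * (_ * ((r⁻¹ : NNReal) : ℝ) ^ m) * ∏ i, ‖v i‖ := by gcongr
    _ = _ := by ring

/-- Factorial bounds for all derivatives of `g` on `U`, as for an `n`-th derivative of an analytic
function. -/
def HasDerivBound (U : Set (Vp p)) (n : ℕ) (C M : ℝ) (g : Vp p → A) : Prop :=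
  ∀ m, ∀ y ∈ U, ‖iteratedFDeriv ℝ m g y‖ ≤ C * (n + m)! * M ^ (n + m)

theorem norm_εc (k : ℕ) (i : Fin (p + 1)) : ‖εc ξ k i‖ = ‖εp p q ξ i‖ := by
  unfold εc εp
  split_ifs <;> simp [norm_smul]

variable {U : Set (Vp p)} {f g : Vp p → A}

theorem pdP_analyticOnNhd [CompleteSpace A] (hg : AnalyticOnNhd ℝ g U) (i : Fin (p + 1)) :
    AnalyticOnNhd ℝ (pdP p i g) U := fun x hx =>
  (ContinuousLinearMap.apply ℝ A (Pi.single i 1 : Vp p)).analyticAt _ |>.comp (hg.fderiv x hx)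

theorem altD_analyticOnNhd [CompleteSpace A] (hg : AnalyticOnNhd ℝ g U) (k : ℕ) :
    AnalyticOnNhd ℝ (altD ξ k g) U :=
  Finset.analyticOnNhd_fun_sum _ fun i _ => analyticOnNhd_const.mul (pdP_analyticOnNhd hg i)

theorem pdP_congr (hU : IsOpen U) (h : Set.EqOn f g U) (i : Fin (p + 1)) :
    Set.EqOn (pdP p i f) (pdP p i g) U := fun x hx => by
  rw [pdP, pdP, (h.eventuallyEq_of_mem (hU.mem_nhds hx)).fderiv_eq]

theorem altD_congr (hU : IsOpen U) (h : Set.EqOn f g U) (k : ℕ) :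
    Set.EqOn (altD ξ k f) (altD ξ k g) U := fun x hx =>
  Finset.sum_congr rfl fun i _ => by rw [pdP_congr hU h i hx]

theorem altD_const_smul (k : ℕ) (c : ℝ) (g : Vp p → A) (x : Vp p) :
    altD ξ k (fun y => c • g y) x = c • altD ξ k g x := by
  have : fderiv ℝ (fun y => c • g y) x = c • fderiv ℝ g x :=
    congrFun (fderiv_const_smul_field (𝕜 := ℝ) (f := g) c) x
  simp [altD, pdP, this, Finset.smul_sum]

theorem altD_congr_parity {k l : ℕ} (h : Even k ↔ Even l) (g : Vp p → A) :
    altD ξ k g = altD ξ l g := by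
  ext x
  simp only [altD, εc_congr ξ h]

theorem altD_zero (g : Vp p → A) : altD ξ 0 g = DPfun p q ξ g := by
  ext x
  simp [altD, DPfun, εc_zero]

/-- The factorization `Δ_{𝐱_p} = D̄_{𝐱_p} D_{𝐱_p}`. -/
theorem altD_one_DPfun [CompleteSpace A] (hg : AnalyticOnNhd ℝ g U) {x : Vp p} (hx : x ∈ U) :
    altD ξ 1 (DPfun p q ξ g) x = LapP p g x := by
  have hd : ∀ j, DifferentiableAt ℝ (pdP p j g) x := fun j =>
    (pdP_analyticOnNhd hg j x hx).differentiableAt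
  have h1 : ∀ i, pdP p i (DPfun p q ξ g) x = ∑ j, εp p q ξ j * pdP p i (pdP p j g) x := by
    intro i
    have : HasFDerivAt (DPfun p q ξ g)
        (∑ j, (ContinuousLinearMap.mul ℝ A (εp p q ξ j)).comp (fderiv ℝ (pdP p j g) x)) x :=
      HasFDerivAt.fun_sum fun j _ =>
        (ContinuousLinearMap.mul ℝ A (εp p q ξ j)).hasFDerivAt.comp x (hd j).hasFDerivAt
    rw [pdP, this.fderiv]
    simp [pdP]
  have h2 : ∀ i j, pdP p i (pdP p j g) x =
      fderiv ℝ (fderiv ℝ g) x (Pi.single i 1) (Pi.single j 1) := by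
    intro i j
    have : HasFDerivAt (pdP p j g) ((ContinuousLinearMap.apply ℝ A (Pi.single j 1 : Vp p)).comp
        (fderiv ℝ (fderiv ℝ g) x)) x :=
      (ContinuousLinearMap.apply ℝ A (Pi.single j 1 : Vp p)).hasFDerivAt.comp x
        (hg.fderiv x hx).differentiableAt.hasFDerivAt
    rw [pdP, this.fderiv]
    simp
  have hsymm : ∀ i j, pdP p i (pdP p j g) x = pdP p j (pdP p i g) x := by
    intro i j
    rw [h2, h2]
    exact ((hg x hx).contDiffAt.isSymmSndFDerivAt (n := 2) (by simp)).eq _ _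
  simp only [altD, h1, Finset.mul_sum, ← mul_assoc]
  rw [sum_sum_mul_of_anticomm (fun i j => εc ξ 1 i * εp p q ξ j)
    (fun i j => pdP p i (pdP p j g) x) 1 (fun i j hij => εc_one_mul_anticomm ξ hij)
    (fun i => εc_one_mul_self ξ i) hsymm]
  simp [LapP]

theorem LapP_iterate_analyticOnNhd [CompleteSpace A] (hg : AnalyticOnNhd ℝ g U) (k : ℕ) :
    AnalyticOnNhd ℝ ((LapP p)^[k] g) U := by
  induction k with
  | zero => exact hg
  | succ k ih =>
    rw [Function.iterate_succ_apply']
    exact Finset.analyticOnNhd_fun_sum _ fun i _ =>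
      pdP_analyticOnNhd (pdP_analyticOnNhd ih i) i

theorem gckCoeff_analyticOnNhd [CompleteSpace A] (hg : AnalyticOnNhd ℝ g U) (k : ℕ) :
    AnalyticOnNhd ℝ (gckCoeff p q ξ g k) U := by
  unfold gckCoeff
  split_ifs
  · exact analyticOnNhd_const.smul (LapP_iterate_analyticOnNhd hg _)
  · rw [← altD_zero]
    exact analyticOnNhd_const.smul (altD_analyticOnNhd ξ (LapP_iterate_analyticOnNhd hg _) 0)

theorem gckCoeff_zero (hq : 1 ≤ q) (f : Vp p → A) : gckCoeff p q ξ f 0 = f := by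
  have : 0 < (q : ℝ) / 2 := by positivity
  ext x
  simp [(Real.Gamma_pos_of_pos this).ne', gckCoeff]

/-- The recursion for the coefficients of the generalized CK-extension. -/
theorem altD_gckCoeff [CompleteSpace A] (hq : 1 ≤ q) (hg : AnalyticOnNhd ℝ g U) (k : ℕ)
    {x : Vp p} (hx : x ∈ U) :
    altD ξ k (gckCoeff p q ξ g k) x = diracCoeff q k • gckCoeff p q ξ g (k + 1) x := by
  have hq2 : 0 < (q : ℝ) / 2 := by positivity
  obtain ⟨j, rfl | rfl⟩ := Nat.even_or_odd' k
  · have e1 : (2 * j + 1) / 2 = j := by omega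
    have e2 : (2 * j + 1) % 2 ≠ 0 := by omega
    have e3 : 2 * j / 2 = j := by omega
    have hΓ := (Real.Gamma_pos_of_pos (add_pos_of_nonneg_of_pos (Nat.cast_nonneg j) hq2)).ne'
    have hj : (j : ℝ) + q / 2 ≠ 0 := by positivity
    rw [altD_congr_parity ξ (l := 0) (by simp)]
    simp only [gckCoeff, Nat.mul_mod_right, if_true, e1, e2, if_false, e3, diracCoeff]
    rw [altD_const_smul, altD_zero, smul_smul, Real.Gamma_add_one hj]
    congr 1
    push_cast
    field_simp
    ring
  · have e1 : (2 * j + 1 + 1) / 2 = j + 1 := by omega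
    have e2 : (2 * j + 1 + 1) % 2 = 0 := by omega
    have e3 : (2 * j + 1) / 2 = j := by omega
    have e4 : (2 * j + 1) % 2 ≠ 0 := by omega
    rw [altD_congr_parity ξ (l := 1) (by simp)]
    simp only [gckCoeff, if_true, e1, e2, if_false, e3, e4, diracCoeff]
    rw [altD_const_smul, altD_one_DPfun ξ (LapP_iterate_analyticOnNhd hg j) hx, smul_smul,
      Function.iterate_succ_apply']
    congr 1
    have : ((j + 1 : ℕ) : ℝ) + q / 2 = j + q / 2 + 1 := by push_cast; ring
    rw [this, Nat.factorial_succ]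
    have hΓ := (Real.Gamma_pos_of_pos (add_pos_of_nonneg_of_pos (Nat.cast_nonneg j) hq2)).ne'
    have hj : (j : ℝ) + q / 2 ≠ 0 := by positivity
    rw [Real.Gamma_add_one hj]
    push_cast
    field_simp
    ring

theorem eqOn_gckCoeff [CompleteSpace A] (hq : 1 ≤ q) (hU : IsOpen U) (hg : AnalyticOnNhd ℝ g U)
    {fs : ℕ → Vp p → A} (h0 : Set.EqOn (fs 0) g U)
    (hrec : ∀ k, ∀ x ∈ U, altD ξ k (fs k) x = diracCoeff q k • fs (k + 1) x) (k : ℕ) :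
    Set.EqOn (fs k) (gckCoeff p q ξ g k) U := by
  induction k with
  | zero => rwa [gckCoeff_zero ξ hq]
  | succ k ih =>
    intro x hx
    have := altD_congr ξ hU ih k hx
    rw [hrec k x hx, altD_gckCoeff ξ hq hg k hx] at this
    exact smul_right_injective A (diracCoeff_pos hq k).ne' this

theorem HasDerivBound.congr (hU : IsOpen U) {n : ℕ} {C M : ℝ} (hf : HasDerivBound U n C M f)
    (h : Set.EqOn f g U) : HasDerivBound U n C M g := fun m y hy => by
  rw [← ((h.eventuallyEq_of_mem (hU.mem_nhds hy)).iteratedFDeriv (𝕜 := ℝ) m).eq_of_nhds]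
  exact hf m y hy

theorem HasDerivBound.altD [CompleteSpace A] {n : ℕ} {C M : ℝ} (hg : AnalyticOnNhd ℝ g U)
    (h : HasDerivBound U n C M g) (k : ℕ) :
    HasDerivBound U (n + 1) ((∑ i, ‖εp p q ξ i‖) * C) M (altD ξ k g) := fun m y hy => by
  have hD : ∀ i, ContDiffAt ℝ m (fun x => εc ξ k i * pdP p i g x) y := fun i =>
    contDiffAt_const.mul (pdP_analyticOnNhd hg i y hy).contDiffAt
  unfold GPS.altD
  rw [iteratedFDeriv_fun_sum_apply fun i _ => hD i, Finset.sum_mul, Finset.sum_mul, Finset.sum_mul]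
  refine norm_sum_le_of_le _ fun i _ => ?_
  have hlin : (fun x => εc ξ k i * pdP p i g x) =
      ((ContinuousLinearMap.mul ℝ A (εc ξ k i)).comp
        (ContinuousLinearMap.apply ℝ A (Pi.single i 1 : Vp p))) ∘ fderiv ℝ g := by
    ext x; simp [pdP]
  rw [hlin]
  refine (ContinuousLinearMap.norm_iteratedFDeriv_comp_left _
    ((hg.fderiv y hy).contDiffAt (n := m)) le_rfl).trans ?_
  rw [norm_iteratedFDeriv_fderiv, mul_assoc, mul_assoc, ← mul_assoc C]
  have hn : n + 1 + m = n + (m + 1) := by ring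
  rw [hn]
  refine mul_le_mul ?_ (h _ y hy) (norm_nonneg _) (norm_nonneg _)
  refine ContinuousLinearMap.opNorm_le_bound _ (norm_nonneg _) fun l => ?_
  simp only [ContinuousLinearMap.comp_apply, ContinuousLinearMap.apply_apply,
    ContinuousLinearMap.mul_apply']
  refine (norm_mul_le _ _).trans ?_
  rw [norm_εc]
  gcongr
  refine (l.le_opNorm _).trans ?_
  rw [Pi.norm_single, norm_one, mul_one]

theorem HasDerivBound.const_smul [CompleteSpace A] {n : ℕ} {C M : ℝ} (hg : AnalyticOnNhd ℝ g U)
    (h : HasDerivBound U n C M g) (c : ℝ) :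
    HasDerivBound U n (|c| * C) M (fun x => c • g x) := fun m y hy => by
  have : iteratedFDeriv ℝ m (fun x => c • g x) y = c • iteratedFDeriv ℝ m g y :=
    iteratedFDeriv_const_smul_apply (f := g) (a := c) (hg y hy).contDiffAt
  rw [this, norm_smul, Real.norm_eq_abs, mul_assoc, mul_assoc, ← mul_assoc C]
  gcongr
  exact h m y hy

theorem gckCoeff_hasDerivBound [CompleteSpace A] (hq : 1 ≤ q) (hU : IsOpen U)
    (hg : AnalyticOnNhd ℝ g U) {C M : ℝ} (hC : 0 ≤ C) (hM : 0 ≤ M) (h : HasDerivBound U 0 C M g)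
    (k : ℕ) :
    HasDerivBound U k (C * (∑ i, ‖εp p q ξ i‖) ^ k / k !) M (gckCoeff p q ξ g k) := by
  induction k with
  | zero => simpa [gckCoeff_zero ξ hq] using h
  | succ k ih =>
    have h1 := ((ih.altD ξ (gckCoeff_analyticOnNhd ξ hg k) k).const_smul
      (altD_analyticOnNhd ξ (gckCoeff_analyticOnNhd ξ hg k) k) (diracCoeff q k)⁻¹).congr
      (g := gckCoeff p q ξ g (k + 1)) hU fun x hx => by
        simp only [altD_gckCoeff ξ hq hg k hx, smul_smul,
          inv_mul_cancel₀ (diracCoeff_pos hq k).ne', one_smul]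
    intro m y hy
    refine (h1 m y hy).trans ?_
    have hK : 0 ≤ ∑ i, ‖εp p q ξ i‖ := Finset.sum_nonneg fun i _ => norm_nonneg _
    gcongr
    rw [abs_of_pos (inv_pos.2 (diracCoeff_pos hq k)), Nat.factorial_succ]
    calc _ ≤ (k + 1 : ℝ)⁻¹ * ((∑ i, ‖εp p q ξ i‖) * (C * (∑ i, ‖εp p q ξ i‖) ^ k / k !)) := by
          gcongr
          exact succ_le_diracCoeff hq k
      _ = _ := by
          push_cast
          field_simp
          ring

/-- Locally uniform geometric bounds for the coefficients. -/
theorem exists_gckCoeff_bound [CompleteSpace A] (hq : 1 ≤ q) (hU : IsOpen U)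
    (hg : AnalyticOnNhd ℝ g U) {x : Vp p} (hx : x ∈ U) :
    ∃ r > 0, ball x r ⊆ U ∧ ∃ B M : ℝ, 0 ≤ M ∧ ∀ k, ∀ y ∈ ball x r,
      ‖gckCoeff p q ξ g k y‖ ≤ B * M ^ k ∧ ‖fderiv ℝ (gckCoeff p q ξ g k) y‖ ≤ B * M ^ k := by
  obtain ⟨r₁, hr₁, C, hC, M, hM, hbd⟩ := exists_norm_iteratedFDeriv_le (hg x hx)
  obtain ⟨r₂, hr₂, hsub⟩ := Metric.isOpen_iff.1 hU x hx
  have hs : ball x (min r₁ r₂) ⊆ U := (ball_subset_ball (min_le_right _ _)).trans hsub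
  have h0 : HasDerivBound (ball x (min r₁ r₂)) 0 C M g := fun m y hy => by
    simpa using hbd m y (ball_subset_ball (min_le_left _ _) hy)
  set K := ∑ i, ‖εp p q ξ i‖ with hK
  have hK0 : 0 ≤ K := Finset.sum_nonneg fun i _ => norm_nonneg _
  refine ⟨min r₁ r₂, lt_min hr₁ hr₂, hs, C * (1 + M), 2 * K * M, by positivity, fun k y hy => ?_⟩
  have hb := gckCoeff_hasDerivBound ξ hq isOpen_ball (hg.mono hs) hC hM h0 k
  have h2 : (1 : ℝ) ≤ 2 ^ k := one_le_pow₀ (by norm_num)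
  have hk : (k + 1 : ℝ) ≤ 2 ^ k := by
    exact_mod_cast Nat.lt_two_pow_self (n := k)
  constructor
  · have := hb 0 y hy
    rw [norm_iteratedFDeriv_zero] at this
    refine this.trans ?_
    calc C * K ^ k / k ! * (k + 0)! * M ^ (k + 0) = C * 1 * (1 * K ^ k * M ^ k) := by
          rw [add_zero]; field_simp
      _ ≤ C * (1 + M) * (2 ^ k * K ^ k * M ^ k) := by
          gcongr
          linarith
      _ = _ := by rw [mul_pow, mul_pow]
  · have := hb 1 y hy
    rw [norm_iteratedFDeriv_one] at this
    refine this.trans ?_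
    calc C * K ^ k / k ! * (k + 1)! * M ^ (k + 1) = C * M * ((k + 1) * K ^ k * M ^ k) := by
          rw [Nat.factorial_succ]; push_cast; field_simp; ring
      _ ≤ C * (1 + M) * (2 ^ k * K ^ k * M ^ k) := by
          gcongr
          linarith
      _ = _ := by rw [mul_pow, mul_pow]

section Tube

variable (Ω₀ : Set (Vp p)) (ρ : Vp p → ℝ)

/-- The union of the sets `ball x (ρ x) × {‖w‖ < ρ x}` over the points `x` of `Ω₀`. -/
def tube (E : Type*) [NormedAddCommGroup E] : Set (Vp p × E) :=
  {z | ∃ x ∈ Ω₀, z.1 ∈ ball x (ρ x) ∧ ‖z.2‖ < ρ x}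

variable {Ω₀ ρ} {E : Type*} [NormedAddCommGroup E]

theorem mem_tube_zero (hρ : ∀ x ∈ Ω₀, 0 < ρ x) {x : Vp p} (hx : x ∈ Ω₀) :
    ((x, 0) : Vp p × E) ∈ tube Ω₀ ρ E :=
  ⟨x, hx, mem_ball_self (hρ x hx), by simpa using hρ x hx⟩

theorem tube_eq_biUnion : tube Ω₀ ρ E = ⋃ x ∈ Ω₀, ball x (ρ x) ×ˢ ball (0 : E) (ρ x) := by
  ext z
  simp [tube, and_left_comm]

theorem isOpen_tube : IsOpen (tube Ω₀ ρ E) := by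
  rw [tube_eq_biUnion]
  exact isOpen_biUnion fun x _ => isOpen_ball.prod isOpen_ball

theorem isDomain_tube [NormedSpace ℝ E] (hΩ₀ : IsDomain Ω₀) (hρ : ∀ x ∈ Ω₀, 0 < ρ x) :
    IsDomain (tube Ω₀ ρ E) := by
  obtain ⟨x₀, hx₀⟩ := hΩ₀.2.nonempty
  refine ⟨isOpen_tube, ⟨_, mem_tube_zero hρ hx₀⟩, ?_⟩
  have hbase : IsPreconnected ((fun x : Vp p => ((x, 0) : Vp p × E)) '' Ω₀) :=
    hΩ₀.2.isPreconnected.image _ (by fun_prop)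
  refine isPreconnected_of_forall ((x₀, 0) : Vp p × E) fun z hz => ?_
  obtain ⟨x, hx, h1, h2⟩ := hz
  refine ⟨(fun x : Vp p => ((x, 0) : Vp p × E)) '' Ω₀ ∪ ball x (ρ x) ×ˢ ball (0 : E) (ρ x),
    ?_, .inl ⟨x₀, hx₀, rfl⟩, .inr ⟨h1, by simpa using h2⟩, ?_⟩
  · rintro _ (⟨y, hy, rfl⟩ | hw)
    · exact mem_tube_zero hρ hy
    · exact ⟨x, hx, hw.1, by simpa using hw.2⟩
  · refine IsPreconnected.union ((x, 0) : Vp p × E) ⟨x, hx, rfl⟩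
      ⟨mem_ball_self (hρ x hx), mem_ball_self (hρ x hx)⟩ hbase ?_
    exact ((convex_ball _ _).prod (convex_ball _ _)).isPreconnected

theorem norm_eq_one_of_mem_S {v : Vq q} (hv : v ∈ S q) : ‖v‖ = 1 := by
  have h : ∑ j, v j ^ 2 = 1 := hv
  simp [EuclideanSpace.norm_eq, h]

theorem sliceSet_tube {v : Vq q} (hv : v ∈ S q) :
    sliceSet p q (tube Ω₀ ρ (Vq q)) v = tube Ω₀ ρ ℝ := by
  ext z
  simp [sliceSet, spt, tube, norm_smul, norm_eq_one_of_mem_S hv]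

theorem isPSymmetric_tube : IsPSymmetric p q (tube Ω₀ ρ (Vq q)) := by
  intro x r v hv w hw
  simp [tube, norm_smul, norm_eq_one_of_mem_S hv, norm_eq_one_of_mem_S hw]

theorem isSliceDomain_tube (hΩ₀ : IsDomain Ω₀) (hρ : ∀ x ∈ Ω₀, 0 < ρ x) :
    IsSliceDomain p q (tube Ω₀ ρ (Vq q)) := by
  obtain ⟨x₀, hx₀⟩ := hΩ₀.2.nonempty
  refine ⟨isDomain_tube hΩ₀ hρ, ⟨x₀, mem_tube_zero hρ hx₀⟩, fun v hv => ?_⟩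
  rw [sliceSet_tube hv]
  exact isDomain_tube hΩ₀ hρ

end Tube

theorem exists_ball_norm_ωCl_le {M : ℝ} (hM : 0 ≤ M) :
    ∃ a > 0, a * M < 1 ∧ ∃ s > 0, ∀ v ∈ ball (0 : Vq q) s, ‖ωCl p q ξ v‖ ≤ a := by
  have ha : 0 < (M + 1)⁻¹ := by positivity
  refine ⟨(M + 1)⁻¹, ha, ?_, (M + 1)⁻¹ / (‖ωL (p := p) (q := q) ξ‖ + 1), by positivity,
    fun v hv => ?_⟩
  · rw [inv_mul_lt_iff₀ (by positivity)]
    linarith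
  · rw [mem_ball_zero_iff] at hv
    calc ‖ωL ξ v‖ ≤ ‖ωL (p := p) (q := q) ξ‖ * ‖v‖ := (ωL ξ).le_opNorm v
      _ ≤ (‖ωL (p := p) (q := q) ξ‖ + 1) *
          ((M + 1)⁻¹ / (‖ωL (p := p) (q := q) ξ‖ + 1)) := by gcongr; linarith
      _ = _ := by field_simp

/-- The series with coefficients `gckCoeff` converges to a monogenic function in a tube. -/
theorem exists_tube_gck [CompleteSpace A] (hq : 1 ≤ q) {Ω₀ : Set (Vp p)} (hU : IsOpen Ω₀)
    {f₀ : Vp p → A} (hf₀ : AnalyticOnNhd ℝ f₀ Ω₀) :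
    ∃ ρ : Vp p → ℝ, (∀ x ∈ Ω₀, 0 < ρ x) ∧ (∀ x ∈ Ω₀, ball x (ρ x) ⊆ Ω₀) ∧
      (∀ z ∈ tube Ω₀ ρ (Vq q), HasSum (fun k => gckTerm p q ξ f₀ k z) (GCKext p q ξ f₀ z)) ∧
      MonogenicOn p q ξ (tube Ω₀ ρ (Vq q)) (GCKext p q ξ f₀) := by
  have hloc : ∀ x ∈ Ω₀, ∃ ρ > 0, ball x ρ ⊆ Ω₀ ∧ ∀ z ∈ ball x ρ ×ˢ ball (0 : Vq q) ρ,
      Summable (fun k => gckTerm p q ξ f₀ k z) ∧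
      ContDiffAt ℝ 1 (GCKext p q ξ f₀) z ∧ DV p q ξ (GCKext p q ξ f₀) z = 0 := by
    intro x hx
    obtain ⟨r, hr, hsub, B, M, hM, hbd⟩ := exists_gckCoeff_bound ξ hq hU hf₀ hx
    obtain ⟨a, ha, haM, s, hs, hω⟩ := exists_ball_norm_ωCl_le (p := p) (q := q) ξ hM
    refine ⟨min r s, lt_min hr hs, (ball_subset_ball (min_le_left _ _)).trans hsub, ?_⟩
    intro z hz
    have hz' : z ∈ ball x r ×ˢ ball (0 : Vq q) s :=
      ⟨ball_subset_ball (min_le_left _ _) hz.1, ball_subset_ball (min_le_right _ _) hz.2⟩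
    have hc := (convex_ball x r).isPreconnected
    have han := fun k => (gckCoeff_analyticOnNhd ξ hf₀ k).mono hsub
    refine ⟨(hasFDerivAt_tsum_axTerm ξ isOpen_ball hc ha hM haM hω
      (fun k y hy => (han k y hy).differentiableAt) (fun k y hy => (hbd k y hy).1)
      (fun k y hy => (hbd k y hy).2) hz').1, ?_⟩
    exact contDiffAt_and_DV_tsum_axTerm ξ isOpen_ball hc ha hM haM hω
      (fun k => (han k).contDiffOn (isOpen_ball.uniqueDiffOn)) (fun k y hy => (hbd k y hy).1)
      (fun k y hy => (hbd k y hy).2)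
      (fun k y hy => altD_gckCoeff ξ hq hf₀ k (hsub hy)) hz'
  choose! ρ hρ hsub h using hloc
  have h' : ∀ z ∈ tube Ω₀ ρ (Vq q), _ := fun z ⟨x, hx, h1, h2⟩ =>
    h x hx z ⟨h1, mem_ball_zero_iff.2 h2⟩
  exact ⟨ρ, hρ, hsub, fun z hz => (h' z hz).1.hasSum,
    fun z hz => (h' z hz).2.1.contDiffWithinAt, fun z hz => (h' z hz).2.2⟩

section TestFunctions

variable {F : Type*} [NormedAddCommGroup F] [NormedSpace ℝ F] {U : Set (Vp p)} {η θ : Vp p → ℝ}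

theorem integrable_smul_of_tsupport (hU : IsOpen U) (hη : Continuous η)
    (hc : HasCompactSupport η) (hs : tsupport η ⊆ U) {f : Vp p → F} (hf : ContinuousOn f U) :
    Integrable (fun x => η x • f x) := by
  refine Continuous.integrable_of_hasCompactSupport ?_ hc.smul_right
  refine ContinuousOn.continuous_of_tsupport_subset (hη.continuousOn.smul hf) hU ?_
  exact (tsupport_smul_subset_left η f).trans hs

theorem hasSum_integral_smul (hU : IsOpen U) (hη : Continuous η)
    (hc : HasCompactSupport η) (hs : tsupport η ⊆ U) {f : ℕ → Vp p → F} {g : Vp p → F}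
    (hf : ∀ k, ContinuousOn (f k) U) {b : ℕ → ℝ} (hb : Summable b)
    (hfb : ∀ k, ∀ x ∈ U, ‖f k x‖ ≤ b k) (hg : ∀ x ∈ U, HasSum (fun k => f k x) (g x)) :
    HasSum (fun k => ∫ x, η x • f k x) (∫ x, η x • g x) := by
  have hout : ∀ x ∉ U, η x = 0 := fun x hx => image_eq_zero_of_notMem_tsupport fun h => hx (hs h)
  refine hasSum_integral_of_dominated_convergence (fun k x => ‖η x‖ * b k)
    (fun k => (integrable_smul_of_tsupport hU hη hc hs (hf k)).aestronglyMeasurable)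
    (fun k => .of_forall fun x => ?_) (.of_forall fun x => hb.mul_left _) ?_
    (.of_forall fun x => ?_)
  · by_cases hx : x ∈ U
    · rw [norm_smul]
      gcongr
      exact hfb k x hx
    · simp [hout x hx]
  · simp only [tsum_mul_left]
    exact ((hη.integrable_of_hasCompactSupport hc).norm).mul_const _
  · by_cases hx : x ∈ U
    · exact (hg x hx).const_smul _
    · simp [hout x hx]

theorem tsupport_pdP_subset (i : Fin (p + 1)) : tsupport (pdP p i θ) ⊆ tsupport θ :=
  tsupport_fderiv_apply_subset ℝ _

theorem continuousOn_pdP {f : Vp p → F} (hU : IsOpen U) (hf : ContDiffOn ℝ 1 f U)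
    (i : Fin (p + 1)) : ContinuousOn (pdP p i f) U :=
  (hf.continuousOn_fderiv_of_isOpen hU le_rfl).clm_apply continuousOn_const

theorem integral_smul_pdP (hU : IsOpen U) (hθ : ContDiff ℝ 1 θ) (hc : HasCompactSupport θ)
    (hs : tsupport θ ⊆ U) {f : Vp p → F} (hf : ContDiffOn ℝ 1 f U) (i : Fin (p + 1)) :
    ∫ x, θ x • pdP p i f x = -∫ x, pdP p i θ x • f x := by
  refine integral_smul_fderiv_eq_neg_fderiv_smul_of_integrable ?_ ?_ ?_
    (fun x _ => hθ.differentiable one_ne_zero x)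
    (fun x hx => (hf.contDiffAt (hU.mem_nhds (hs hx))).differentiableAt one_ne_zero)
  · exact integrable_smul_of_tsupport hU ((hθ.continuous_fderiv one_ne_zero).clm_apply continuous_const)
      (hc.fderiv_apply ℝ _) ((tsupport_pdP_subset i).trans hs) hf.continuousOn
  · exact integrable_smul_of_tsupport hU hθ.continuous hc hs (continuousOn_pdP hU hf i)
  · exact integrable_smul_of_tsupport hU hθ.continuous hc hs hf.continuousOn

end TestFunctions

section Weak

variable {U : Set (Vp p)} {θ η : Vp p → ℝ}

theorem integral_smul_const_mul [CompleteSpace A] (hU : IsOpen U) (hη : Continuous η)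
    (hc : HasCompactSupport η) (hs : tsupport η ⊆ U) {f : Vp p → A} (hf : ContinuousOn f U)
    (c : A) : ∫ x, η x • (c * f x) = c * ∫ x, η x • f x := by
  have := (ContinuousLinearMap.mul ℝ A c).integral_comp_comm
    (integrable_smul_of_tsupport hU hη hc hs hf)
  simpa using this

theorem integral_smul_DPfun [CompleteSpace A] (hU : IsOpen U) (hθ : ContDiff ℝ 1 θ) (hc : HasCompactSupport θ)
    (hs : tsupport θ ⊆ U) {f : Vp p → A} (hf : ContDiffOn ℝ 1 f U) :
    ∫ x, θ x • DPfun p q ξ f x = -∑ i, εp p q ξ i * ∫ x, pdP p i θ x • f x := by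
  have h1 : ∀ i, ∫ x, θ x • (εp p q ξ i * pdP p i f x) =
      -(εp p q ξ i * ∫ x, pdP p i θ x • f x) := fun i => by
    rw [integral_smul_const_mul hU hθ.continuous hc hs (continuousOn_pdP hU hf i),
      integral_smul_pdP hU hθ hc hs hf, mul_neg]
  simp only [DPfun, Finset.smul_sum]
  have h2 : ∀ i, Integrable fun x => θ x • (εp p q ξ i * pdP p i f x) := fun i =>
    integrable_smul_of_tsupport hU hθ.continuous hc hs
      (continuousOn_const.mul (continuousOn_pdP hU hf i))
  rw [integral_finsetSum _ fun i _ => h2 i, ← Finset.sum_neg_distrib]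
  exact Finset.sum_congr rfl fun i _ => h1 i

theorem DPfun_const_mul_pow (k : ℕ) (v : Vq q) {f : Vp p → A} {x : Vp p}
    (hf : DifferentiableAt ℝ f x) :
    DPfun p q ξ (fun y => ωCl p q ξ v ^ k * f y) x = ωCl p q ξ v ^ k * altD ξ k f x := by
  rw [← sum_εp_mul_ωCl_pow_mul_fderiv]
  refine Finset.sum_congr rfl fun i _ => ?_
  rw [pdP, fderiv_const_mul hf]
  simp

/-- Termwise application of `D_{𝐱_p}`, in the weak sense. -/
theorem hasSum_integral_smul_DPfun [CompleteSpace A] (hU : IsOpen U) (hθ : ContDiff ℝ 1 θ)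
    (hc : HasCompactSupport θ) (hs : tsupport θ ⊆ U) {f : ℕ → Vp p → A} {g : Vp p → A}
    (hf : ∀ k, ContDiffOn ℝ 1 (f k) U) (hgd : ContDiffOn ℝ 1 g U) {b : ℕ → ℝ} (hb : Summable b)
    (hfb : ∀ k, ∀ x ∈ U, ‖f k x‖ ≤ b k) (hg : ∀ x ∈ U, HasSum (fun k => f k x) (g x)) :
    HasSum (fun k => ∫ x, θ x • DPfun p q ξ (f k) x) (∫ x, θ x • DPfun p q ξ g x) := by
  simp only [integral_smul_DPfun ξ hU hθ hc hs (hf _), integral_smul_DPfun ξ hU hθ hc hs hgd]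
  have key : ∀ i, HasSum (fun k => ∫ x, pdP p i θ x • f k x) (∫ x, pdP p i θ x • g x) := fun i =>
    hasSum_integral_smul hU ((hθ.continuous_fderiv one_ne_zero).clm_apply continuous_const)
    (hc.fderiv_apply ℝ _) ((tsupport_pdP_subset i).trans hs) (fun k => (hf k).continuousOn)
      hb hfb hg
  exact HasSum.neg (hasSum_sum fun i _ => (key i).mul_left _)

end Weak

/-- A power series of a real variable with zero sum near `0` has zero coefficients. -/
theorem eq_zero_of_hasSum_pow_smul {F : Type*} [NormedAddCommGroup F] [NormedSpace ℝ F]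
    {c : ℕ → F} (h : ∀ᶠ r : ℝ in 𝓝 0, HasSum (fun k => r ^ k • c k) 0) (k : ℕ) : c k = 0 := by
  set P : FormalMultilinearSeries ℝ ℝ F :=
    fun n => ContinuousMultilinearMap.mkPiRing ℝ (Fin n) (c n) with hP
  have hcoeff : ∀ n, P.coeff n = c n := fun n => by simp [hP, FormalMultilinearSeries.coeff]
  have : HasFPowerSeriesAt (0 : ℝ → F) P 0 := by
    rw [hasFPowerSeriesAt_iff]
    simpa [hcoeff] using h
  rw [← hcoeff, this.eq_zero]
  rfl

/-- Termwise differentiation of a monogenic series in the `ℝ^q` directions only. -/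
theorem hasSum_sum_εp_mul_pdV1 [CompleteSpace A] {a B M s : ℝ} (ha : 0 < a) (hM : 0 ≤ M)
    (haM : a * M < 1) (hs : ∀ v ∈ ball (0 : Vq q) s, ‖ωCl p q ξ v‖ ≤ a) {c : ℕ → A}
    (hc : ∀ k, ‖c k‖ ≤ B * M ^ k) {g : V p q → A} {x : Vp p} {v : Vq q}
    (hv : v ∈ ball (0 : Vq q) s) (hgd : DifferentiableAt ℝ g (x, v)) (hg0 : DV p q ξ g (x, v) = 0)
    (hg : ∀ w ∈ ball (0 : Vq q) s, HasSum (fun k => ωCl p q ξ w ^ k * c k) (g (x, w))) :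
    HasSum (fun k => ωCl p q ξ v ^ k * (diracCoeff q k • c (k + 1)))
      (∑ i, εp p q ξ i * pdV1 p q i g (x, v)) := by
  set fs : ℕ → Vp p → A := fun k _ => c k with hfs
  have hB : 0 ≤ B := by simpa using (norm_nonneg _).trans (hc 0)
  have key := hasFDerivAt_tsum_axTerm ξ (fs := fs) (z := (x, v)) isOpen_univ isPreconnected_univ
    ha hM haM hs (fun k y _ => differentiableAt_const _) (fun k y _ => hc k)
    (fun k y _ => by simp [hfs]; positivity) ⟨trivial, hv⟩
  obtain ⟨-, hsum, hder⟩ := key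
  set L := ∑' k, fderiv ℝ (axTerm ξ fs k) (x, v)
  have h1 := hasSum_symbolDV ξ hsum.hasSum
  rw [← hasSum_nat_add_iff' 1] at h1
  have haltD : ∀ k, altD ξ k (fs k) x = 0 := fun k => by simp [altD, pdP, hfs]
  have hterm : ∀ k, symbolDV ξ (fderiv ℝ (axTerm ξ fs (k + 1)) (x, v)) =
      -(ωCl p q ξ v ^ k * (diracCoeff q k • c (k + 1))) := fun k => by
    rw [symbolDV_fderiv_axTerm_succ ξ (differentiableAt_const _), haltD]
    simp [hfs]
  have hterm0 : symbolDV ξ (fderiv ℝ (axTerm ξ fs 0) (x, v)) = 0 := by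
    rw [symbolDV_fderiv_axTerm_zero ξ (differentiableAt_const _), haltD]
  simp only [hterm, Finset.sum_range_one, hterm0, sub_zero] at h1
  have hL1 : ∀ w, L (w, 0) = 0 := fun w => by
    have h := hder.comp (f := fun y : Vp p => (y, v)) x (hasFDerivAt_prodMk_left x v)
    have hconst : ((fun z => ∑' k, axTerm ξ fs k z) ∘ fun y : Vp p => (y, v)) =
      fun _ => ∑' k, ωCl p q ξ v ^ k * c k := rfl
    rw [hconst] at h
    simpa using congrArg (fun l : Vp p →L[ℝ] A => l w) (h.unique (hasFDerivAt_const _ _))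
  have hL2 : ∀ w, L (0, w) = fderiv ℝ g (x, v) (0, w) := fun w => by
    have h := hder.comp (f := fun y : Vq q => (x, y)) v (hasFDerivAt_prodMk_right x v)
    have h' := hgd.hasFDerivAt.comp (f := fun y : Vq q => (x, y)) v (hasFDerivAt_prodMk_right x v)
    have heq : (g ∘ fun y : Vq q => (x, y)) =ᶠ[𝓝 v]
        ((fun z => ∑' k, axTerm ξ fs k z) ∘ fun y : Vq q => (x, y)) := by
      filter_upwards [isOpen_ball.mem_nhds hv] with y hy
      exact (hg y hy).tsum_eq.symm
    simpa using congrArg (fun l : Vq q →L[ℝ] A => l w) (h.unique (h'.congr_of_eventuallyEq heq.symm))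
  have hLs : symbolDV ξ L = -∑ i, εp p q ξ i * pdV1 p q i g (x, v) := by
    rw [eq_neg_iff_add_eq_zero, ← hg0, add_comm]
    simp [symbolDV, hL1, hL2, DV, pdV2]
  rw [hLs] at h1
  simpa using h1.neg

theorem diracCoeff_le (hq : 1 ≤ q) (k : ℕ) : diracCoeff q k ≤ k + q := by
  have : (1 : ℝ) ≤ q := by exact_mod_cast hq
  unfold diracCoeff
  split_ifs <;> linarith

/-- The recursion for the coefficients of a monogenic series with uniform geometric bounds. -/
theorem altD_eq_of_bound [CompleteSpace A] (hq : 1 ≤ q) {U : Set (Vp p)} (hU : IsOpen U)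
    {fs : ℕ → Vp p → A} (hfs : ∀ k, AnalyticOnNhd ℝ (fs k) U) {B M δ : ℝ} (hM : 0 ≤ M)
    (hδ : 0 < δ) (hB : ∀ k, ∀ x ∈ U, ‖fs k x‖ ≤ B * M ^ k) {g : V p q → A}
    (hg : ∀ z ∈ U ×ˢ ball (0 : Vq q) δ, HasSum (fun k => ωCl p q ξ z.2 ^ k * fs k z.1) (g z))
    (hmon : MonogenicOn p q ξ (U ×ˢ ball (0 : Vq q) δ) g) (k : ℕ) {x : Vp p} (hx : x ∈ U) :
    altD ξ k (fs k) x = diracCoeff q k • fs (k + 1) x := by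
  obtain ⟨a, ha, haM, s, hs, hω⟩ := exists_ball_norm_ωCl_le (p := p) (q := q) ξ hM
  set v₀ : Vq q := EuclideanSpace.single ⟨0, hq⟩ 1 with hv₀
  have hv₀n : ‖v₀‖ = 1 := by simp [hv₀]
  have hB0 : 0 ≤ B := by simpa using (norm_nonneg _).trans (hB 0 x hx)
  have hO : IsOpen (U ×ˢ ball (0 : Vq q) δ) := hU.prod isOpen_ball
  have hC1 : ∀ k, ContDiffOn ℝ 1 (fs k) U := fun k => (hfs k).contDiffOn hU.uniqueDiffOn
  set u : ℕ → Vp p → A := fun k y => altD ξ k (fs k) y - diracCoeff q k • fs (k + 1) y with hu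
  have hA : ∀ k, ContinuousOn (altD ξ k (fs k)) U := fun k =>
    (altD_analyticOnNhd ξ (hfs k) k).continuousOn
  have hF : ∀ k, ContinuousOn (fun y => diracCoeff q k • fs (k + 1) y) U := fun k =>
    continuousOn_const.smul (hfs (k + 1)).continuousOn
  have huc : ∀ k, ContinuousOn (u k) U := fun k => (hA k).sub (hF k)
  suffices h : ∀ θ : Vp p → ℝ, ContDiff ℝ (⊤ : ℕ∞) θ → HasCompactSupport θ → tsupport θ ⊆ U →
      ∀ k, ∫ y, θ y • u k y = 0 by
    have h0 := hU.ae_eq_zero_of_integral_contDiff_smul_eq_zero (μ := volume)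
      ((huc k).locallyIntegrableOn hU.measurableSet)
      (fun θ h1 h2 h3 => h θ h1 h2 h3 k)
    have h1 := Measure.eqOn_open_of_ae_eq (μ := volume) (f := u k) (g := 0)
      ((ae_restrict_iff' hU.measurableSet).2 h0) hU (huc k) continuousOn_const
    exact sub_eq_zero.1 (h1 hx)
  intro θ hθ hc hsupp k
  have hθ1 : ContDiff ℝ 1 θ := hθ.of_le (by simp)
  have hint : ∀ (v : Vq q) k, ∫ y, θ y • (ωCl p q ξ v ^ k * u k y) =
      ωCl p q ξ v ^ k * ∫ y, θ y • u k y := fun v k =>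
    integral_smul_const_mul hU hθ.continuous hc hsupp (huc k) _
  have hev : ∀ᶠ r : ℝ in 𝓝 0,
      HasSum (fun k => r ^ k • (ωCl p q ξ v₀ ^ k * ∫ y, θ y • u k y)) 0 := by
    filter_upwards [ball_mem_nhds (0 : ℝ) (lt_min hs hδ)] with r hr
    rw [mem_ball_zero_iff, lt_min_iff] at hr
    set v := r • v₀ with hv
    have hvn : ‖v‖ = ‖r‖ := by simp [hv, norm_smul, hv₀n]
    have hvs : v ∈ ball (0 : Vq q) s := by simpa [hvn] using hr.1
    have hvδ : v ∈ ball (0 : Vq q) δ := by simpa [hvn] using hr.2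
    have hgC : ∀ y ∈ U, ContDiffAt ℝ 1 g (y, v) := fun y hy =>
      hmon.1.contDiffAt (hO.mem_nhds ⟨hy, hvδ⟩)
    have hGd : ContDiffOn ℝ 1 (fun y => g (y, v)) U := fun y hy =>
      ((hgC y hy).comp (f := fun y : Vp p => (y, v)) y
        (contDiffAt_id.prodMk contDiffAt_const)).contDiffWithinAt
    have hGp : ∀ y ∈ U, DPfun p q ξ (fun y => g (y, v)) y =
        ∑ i, εp p q ξ i * pdV1 p q i g (y, v) := fun y hy => by
      refine Finset.sum_congr rfl fun i _ => ?_
      have := ((hgC y hy).differentiableAt one_ne_zero).hasFDerivAt.comp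
        (f := fun y : Vp p => (y, v)) y (hasFDerivAt_prodMk_left y v)
      have h2 : fderiv ℝ (fun y => g (y, v)) y = _ := this.fderiv
      rw [pdP, pdV1, h2]
      simp
    have hs1 : HasSum (fun k => ∫ y, θ y • DPfun p q ξ (fun y => ωCl p q ξ v ^ k * fs k y) y)
        (∫ y, θ y • DPfun p q ξ (fun y => g (y, v)) y) := by
      refine hasSum_integral_smul_DPfun ξ hU hθ1 hc hsupp
        (fun k => contDiffOn_const.mul (hC1 k)) hGd
        (b := fun k => (‖(1 : A)‖ * B) * (a * M) ^ k)
        (by simpa using summable_axTerm_bound ha hM haM (‖(1 : A)‖ * B) 0)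
        (fun k y hy => norm_axTerm_le ξ (z := (y, v)) (hω v hvs) (hB k y hy))
        fun y hy => hg (y, v) ⟨hy, hvδ⟩
    have hs2 : HasSum (fun k => ∫ y, θ y • (ωCl p q ξ v ^ k * (diracCoeff q k • fs (k + 1) y)))
        (∫ y, θ y • DPfun p q ξ (fun y => g (y, v)) y) := by
      refine hasSum_integral_smul hU hθ.continuous hc hsupp
        (b := fun k => (‖(1 : A)‖ * B * M * q) * (a * M) ^ k +
          (‖(1 : A)‖ * B * M) * (k * (a * M) ^ k))
        (fun k => continuousOn_const.mul (hF k)) (summable_axTerm_bound ha hM haM _ _)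
        (fun k y hy => ?_) (fun y hy => ?_)
      · calc ‖ωCl p q ξ v ^ k * (diracCoeff q k • fs (k + 1) y)‖
            ≤ ‖ωCl p q ξ v ^ k‖ * (diracCoeff q k * ‖fs (k + 1) y‖) := by
              refine (norm_mul_le _ _).trans_eq ?_
              rw [norm_smul, Real.norm_of_nonneg (diracCoeff_pos hq k).le]
          _ ≤ (‖(1 : A)‖ * a ^ k) * ((k + q) * (B * M ^ (k + 1))) := by
              have := diracCoeff_le hq k
              have := hB (k + 1) y hy
              have := diracCoeff_pos hq k
              gcongr
              exact (norm_pow_le_norm_one_mul _ _).trans (by gcongr; exact hω v hvs)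
          _ = _ := by rw [mul_pow]; ring
      · rw [hGp y hy]
        refine hasSum_sum_εp_mul_pdV1 ξ ha hM haM (s := min s δ)
          (fun w hw => hω w (ball_subset_ball (min_le_left _ _) hw)) (fun k => hB k y hy)
          (by simpa [hvn] using hr) ((hgC y hy).differentiableAt one_ne_zero)
          (hmon.2 _ ⟨hy, hvδ⟩) fun w hw => ?_
        exact hg (y, w) ⟨hy, ball_subset_ball (min_le_right _ _) hw⟩
    have hdiff := hs1.sub hs2
    rw [sub_self] at hdiff
    have hout : ∀ y ∉ U, θ y = 0 := fun y hy =>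
      image_eq_zero_of_notMem_tsupport fun h => hy (hsupp h)
    have hD : ∀ k y, θ y • DPfun p q ξ (fun y => ωCl p q ξ v ^ k * fs k y) y =
        θ y • (ωCl p q ξ v ^ k * altD ξ k (fs k) y) := fun k y => by
      by_cases hy : y ∈ U
      · rw [DPfun_const_mul_pow ξ k v (hfs k y hy).differentiableAt]
      · simp [hout y hy]
    refine (congrArg (fun F => HasSum F (0 : A)) (funext fun k => ?_)).mp hdiff
    rw [← smul_mul_assoc, ← smul_pow, ← ωCl_smul, ← hint]
    simp only [hD]
    have hI : ∀ {f : Vp p → A}, ContinuousOn f U →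
        Integrable fun y => θ y • (ωCl p q ξ v ^ k * f y) := fun hf =>
      integrable_smul_of_tsupport hU hθ.continuous hc hsupp (continuousOn_const.mul hf)
    rw [← integral_sub (hI (hA k)) (hI (hF k))]
    simp only [hu, mul_sub, smul_sub, hv]
  have h0 := eq_zero_of_hasSum_pow_smul hev k
  calc ∫ y, θ y • u k y = (-ωCl p q ξ v₀) ^ k * (ωCl p q ξ v₀ ^ k * ∫ y, θ y • u k y) := by
        rw [← mul_assoc, neg_ωCl_pow_mul_pow ξ hv₀n, one_mul]
    _ = 0 := by rw [h0, mul_zero]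

/-- A pointwise geometric bound for a sequence of continuous functions is uniform on some
nonempty open subset. -/
theorem exists_isOpen_uniform_bound {X F : Type*} [TopologicalSpace X] [BaireSpace X]
    [RegularSpace X] [NormedAddCommGroup F] {G : Set X} (hG : IsOpen G) (hne : G.Nonempty)
    {f : ℕ → X → F} (hf : ∀ k, ContinuousOn (f k) G) {M : ℝ} (hM : 0 ≤ M)
    (h : ∀ x ∈ G, ∃ C, ∀ k, ‖f k x‖ ≤ C * M ^ k) :
    ∃ U ⊆ G, IsOpen U ∧ U.Nonempty ∧ ∃ B, ∀ k, ∀ x ∈ U, ‖f k x‖ ≤ B * M ^ k := by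
  obtain ⟨x₀, hx₀⟩ := hne
  obtain ⟨K, hK, hKc, hKG⟩ := exists_mem_nhds_isClosed_subset (hG.mem_nhds hx₀)
  set E : ℕ → Set X := fun n =>
    (⋂ k, K ∩ f k ⁻¹' closedBall 0 (n * M ^ k)) ∪ (interior K)ᶜ with hE
  have hEc : ∀ n, IsClosed (E n) := fun n =>
    (isClosed_iInter fun k => ((hf k).mono hKG).preimage_isClosed_of_isClosed hKc
      isClosed_closedBall).union isOpen_interior.isClosed_compl
  have hEu : ⋃ n, E n = Set.univ := by
    refine Set.eq_univ_of_forall fun x => Set.mem_iUnion.2 ?_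
    by_cases hx : x ∈ interior K
    · obtain ⟨C, hC⟩ := h x (hKG (interior_subset hx))
      obtain ⟨n, hn⟩ := exists_nat_ge C
      refine ⟨n, .inl (Set.mem_iInter.2 fun k => ⟨interior_subset hx, ?_⟩)⟩
      rw [Set.mem_preimage, mem_closedBall_zero_iff]
      exact (hC k).trans (by gcongr)
    · exact ⟨0, .inr hx⟩
  obtain ⟨x, hxK, hx⟩ := (dense_iUnion_interior_of_closed hEc hEu).inter_open_nonempty _
    isOpen_interior ⟨x₀, mem_interior_iff_mem_nhds.2 hK⟩
  obtain ⟨n, hn⟩ := Set.mem_iUnion.1 hx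
  refine ⟨interior (E n) ∩ interior K, fun y hy => hKG (interior_subset hy.2),
    isOpen_interior.inter isOpen_interior, ⟨x, hn, hxK⟩, n, fun k y hy => ?_⟩
  rcases interior_subset hy.1 with h1 | h1
  · simpa using (Set.mem_iInter.1 h1 k).2
  · exact absurd hy.2 h1

theorem exists_bound_of_summable (fs : ℕ → A) {v : Vq q} (hv : ‖v‖ = 1) {r : ℝ} (hr : 0 < r)
    (h : Summable fun k => ωCl p q ξ (r • v) ^ k * fs k) :
    ∃ C, ∀ k, ‖fs k‖ ≤ C * (‖ωCl p q ξ v‖ / r) ^ k := by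
  obtain ⟨C, hC⟩ := h.tendsto_atTop_zero.norm.bddAbove_range
  refine ⟨‖(1 : A)‖ * C, fun k => ?_⟩
  have hk : ‖ωCl p q ξ (r • v) ^ k * fs k‖ ≤ C := hC ⟨k, rfl⟩
  have heq : fs k = (r ^ k)⁻¹ • ((-ωCl p q ξ v) ^ k * (ωCl p q ξ (r • v) ^ k * fs k)) := by
    rw [ωCl_smul, smul_pow, smul_mul_assoc, mul_smul_comm, ← mul_assoc,
      neg_ωCl_pow_mul_pow ξ hv, one_mul, smul_smul, inv_mul_cancel₀ (by positivity), one_smul]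
  calc ‖fs k‖ ≤ (r ^ k)⁻¹ * (‖(-ωCl p q ξ v) ^ k‖ * ‖ωCl p q ξ (r • v) ^ k * fs k‖) := by
        conv_lhs => rw [heq]
        rw [norm_smul, Real.norm_of_nonneg (by positivity)]
        gcongr
        exact norm_mul_le _ _
    _ ≤ (r ^ k)⁻¹ * ((‖(1 : A)‖ * ‖ωCl p q ξ v‖ ^ k) * C) := by
        gcongr
        simpa using norm_pow_le_norm_one_mul (-ωCl p q ξ v) k
    _ = _ := by rw [div_pow]; field_simp

/-- The coefficients of a monogenic series satisfy the recursion determined by `D_𝐱`. -/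
theorem altD_eq_of_monogenicOn [CompleteSpace A] (hq : 1 ≤ q) {Ω₀ : Set (Vp p)} (hΩ₀ : IsOpen Ω₀)
    {Ω : Set (V p q)} (hΩ : IsOpen Ω) (hsub : ∀ x ∈ Ω₀, ((x, 0) : V p q) ∈ Ω)
    {fs : ℕ → Vp p → A} (hfs : ∀ k, AnalyticOnNhd ℝ (fs k) Ω₀) {g : V p q → A}
    (hg : ∀ z ∈ Ω, HasSum (fun k => ωCl p q ξ z.2 ^ k * fs k z.1) (g z))
    (hmon : MonogenicOn p q ξ Ω g) (k : ℕ) {x : Vp p} (hx : x ∈ Ω₀) :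
    altD ξ k (fs k) x = diracCoeff q k • fs (k + 1) x := by
  by_contra hne
  have huc : ContinuousOn (fun y => altD ξ k (fs k) y - diracCoeff q k • fs (k + 1) y) Ω₀ :=
    (altD_analyticOnNhd ξ (hfs k) k).continuousOn.sub
      (continuousOn_const.smul (hfs (k + 1)).continuousOn)
  have hev : ∀ᶠ y in 𝓝 x, altD ξ k (fs k) y - diracCoeff q k • fs (k + 1) y ≠ 0 :=
    (huc.continuousAt (hΩ₀.mem_nhds hx)).eventually_ne (sub_ne_zero.2 hne)
  obtain ⟨ε, hε, hεne⟩ := Metric.eventually_nhds_iff_ball.1 (hev.and (hΩ₀.mem_nhds hx))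
  obtain ⟨δ, hδ, hδΩ⟩ := Metric.isOpen_iff.1 hΩ _ (hsub x hx)
  rw [← ball_prod_same] at hδΩ
  set v₀ : Vq q := EuclideanSpace.single ⟨0, hq⟩ 1 with hv₀
  have hv₀n : ‖v₀‖ = 1 := by simp [hv₀]
  have hG : ∀ y ∈ ball x (min ε δ), y ∈ ball x ε ∧ y ∈ ball x δ := fun y hy =>
    ⟨ball_subset_ball (min_le_left _ _) hy, ball_subset_ball (min_le_right _ _) hy⟩
  obtain ⟨U, hUs, hU, ⟨y, hy⟩, B, hB⟩ := exists_isOpen_uniform_bound (G := ball x (min ε δ))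
    (f := fs) (M := ‖ωCl p q ξ v₀‖ / (δ / 2)) isOpen_ball
    ⟨x, mem_ball_self (lt_min hε hδ)⟩
    (fun k => (hfs k).continuousOn.mono fun y hy => (hεne y (hG y hy).1).2) (by positivity)
    fun y hy => by
      refine exists_bound_of_summable ξ (fun k => fs k y) hv₀n (half_pos hδ) ?_
      refine (hg (y, (δ / 2) • v₀) (hδΩ ⟨(hG y hy).2, ?_⟩)).summable
      rw [mem_ball_zero_iff, norm_smul, hv₀n, Real.norm_of_nonneg (by positivity)]
      linarith
  have hUΩ : U ×ˢ ball (0 : Vq q) δ ⊆ Ω := fun z hz => hδΩ ⟨(hG _ (hUs hz.1)).2, hz.2⟩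
  refine (hεne y (hG y (hUs hy)).1).1 (sub_eq_zero.2 ?_)
  exact altD_eq_of_bound ξ hq hU
    (fun k => (hfs k).mono fun y hy => (hεne y (hG y (hUs hy)).1).2) (by positivity) hδ hB
    (fun z hz => hg z (hUΩ hz)) ⟨hmon.1.mono hUΩ, fun z hz => hmon.2 z (hUΩ hz)⟩ k hy

end GPS

open GPS

/-- **Generalized CK-extension** (Theorem 4.6).  For a real analytic
`f₀ : Ω₀ → ℝ_{p+q}` on a domain `Ω₀ ⊆ ℝ^{p+1}` there is a unique sequence of real
analytic functions `{f_k}` (with `f_0 = f₀`) such that the series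
`GCK[f₀] = ∑_k 𝐱_q^k f_k(𝐱_p)` converges on a p-symmetric slice domain
`Ω ⊆ Ω₀*` containing `Ω₀` with monogenic sum; the coefficients are
`f_{2k} = (Γ(q/2)/(2^{2k}k!Γ(k+q/2))) Δ_{𝐱_p}^k f₀` and
`f_{2k+1} = (Γ(q/2)/(2^{2k+1}k!Γ(k+q/2+1))) D_{𝐱_p} Δ_{𝐱_p}^k f₀`. -/
theorem generalized_CK_extension
    (p q : ℕ) (hq : 1 ≤ q) {A : Type*} [NormedRing A] [NormedAlgebra ℝ A]
    (ξ : A ≃ₐ[ℝ] Cl (p + q))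
    (Ω₀ : Set (Vp p)) (hΩ₀ : IsDomain Ω₀)
    (f₀ : Vp p → A) (hf₀ : AnalyticOnNhd ℝ f₀ Ω₀) :
    ∃ Ω : Set (V p q), IsPSymmetric p q Ω ∧ IsSliceDomain p q Ω ∧
      Ω ⊆ star0 p q Ω₀ ∧ (∀ x ∈ Ω₀, ((x, 0) : V p q) ∈ Ω) ∧
      -- existence
      (∃ (fs : ℕ → Vp p → A) (g : V p q → A),
        (∀ k, AnalyticOnNhd ℝ (fs k) Ω₀) ∧ Set.EqOn (fs 0) f₀ Ω₀ ∧
        (∀ z ∈ Ω, HasSum (fun k => (ωCl p q ξ z.2) ^ k * fs k z.1) (g z)) ∧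
        MonogenicOn p q ξ Ω g) ∧
      -- uniqueness
      (∀ (fs fs' : ℕ → Vp p → A) (g g' : V p q → A),
        ((∀ k, AnalyticOnNhd ℝ (fs k) Ω₀) ∧ Set.EqOn (fs 0) f₀ Ω₀ ∧
          (∀ z ∈ Ω, HasSum (fun k => (ωCl p q ξ z.2) ^ k * fs k z.1) (g z)) ∧
          MonogenicOn p q ξ Ω g) →
        ((∀ k, AnalyticOnNhd ℝ (fs' k) Ω₀) ∧ Set.EqOn (fs' 0) f₀ Ω₀ ∧
          (∀ z ∈ Ω, HasSum (fun k => (ωCl p q ξ z.2) ^ k * fs' k z.1) (g' z)) ∧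
          MonogenicOn p q ξ Ω g') →
        (∀ k, Set.EqOn (fs k) (fs' k) Ω₀) ∧ Set.EqOn g g' Ω) ∧
      -- the explicit form of the coefficients
      (∀ (fs : ℕ → Vp p → A) (g : V p q → A),
        ((∀ k, AnalyticOnNhd ℝ (fs k) Ω₀) ∧ Set.EqOn (fs 0) f₀ Ω₀ ∧
          (∀ z ∈ Ω, HasSum (fun k => (ωCl p q ξ z.2) ^ k * fs k z.1) (g z)) ∧
          MonogenicOn p q ξ Ω g) →
        (∀ k, Set.EqOn (fs k) (gckCoeff p q ξ f₀ k) Ω₀) ∧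
        ∀ z ∈ Ω, HasSum (fun k => gckTerm p q ξ f₀ k z) (g z)) := by
  have := completeSpace_of_algEquiv ξ
  obtain ⟨ρ, hρ, hρΩ, hsum, hmon⟩ := exists_tube_gck ξ hq hΩ₀.1 hf₀
  set Ω := tube Ω₀ ρ (Vq q)
  have hstar : Ω ⊆ star0 p q Ω₀ := fun z ⟨x, hx, h1, _⟩ => hρΩ x hx h1
  have hmem : ∀ x ∈ Ω₀, ((x, 0) : V p q) ∈ Ω := fun x hx => mem_tube_zero hρ hx
  have hcoeff : ∀ (fs : ℕ → Vp p → A) (g : V p q → A),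
      ((∀ k, AnalyticOnNhd ℝ (fs k) Ω₀) ∧ Set.EqOn (fs 0) f₀ Ω₀ ∧
        (∀ z ∈ Ω, HasSum (fun k => (ωCl p q ξ z.2) ^ k * fs k z.1) (g z)) ∧
        MonogenicOn p q ξ Ω g) →
      (∀ k, Set.EqOn (fs k) (gckCoeff p q ξ f₀ k) Ω₀) ∧
        ∀ z ∈ Ω, HasSum (fun k => gckTerm p q ξ f₀ k z) (g z) := by
    rintro fs g ⟨hfs, h0, hg, hgmon⟩
    have hEq := fun k => eqOn_gckCoeff ξ hq hΩ₀.1 hf₀ h0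
      (fun k x hx => altD_eq_of_monogenicOn ξ hq hΩ₀.1 isOpen_tube hmem hfs hg hgmon k hx) k
    refine ⟨hEq, fun z hz => ?_⟩
    have hz' := hg z hz
    simp only [hEq _ (hstar hz)] at hz'
    exact hz'
  refine ⟨Ω, isPSymmetric_tube, isSliceDomain_tube hΩ₀ hρ, hstar, hmem,
    ⟨gckCoeff p q ξ f₀, GCKext p q ξ f₀, fun k => gckCoeff_analyticOnNhd ξ hf₀ k,
      fun x _ => by rw [gckCoeff_zero ξ hq], hsum, hmon⟩, ?_, hcoeff⟩
  intro fs fs' g g' h h'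
  have H := hcoeff fs g h
  have H' := hcoeff fs' g' h'
  exact ⟨fun k x hx => (H.1 k hx).trans (H'.1 k hx).symm,
    fun z hz => (H.2 z hz).unique (H'.2 z hz)⟩
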